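/- For every real r with 0 < r < 1 there exist reals δ > 0 and s > 0 and a natural number w such that for every N ∈ ℕ there exist natural numbers n ≥ N and m ≥ 1 and a matrix H over 𝔽₂ = ZMod 2 with m rows and n columns such that: (i) every row of H has at most w nonzero entries; (ii) the code C = {x ∈ 𝔽₂ⁿ : H·x = 0} has 𝔽₂-dimension at least r·n; (iii) every nonzero codeword of C has Hamming weight at least δ·n; and (iv) for every x ∈ 𝔽₂ⁿ, (1/m)·|H·x| ≥ (s/n)·d(x, C), where |·| denotes Hamming weight and d(x, C) = min_{c ∈ C} |x − c|. -/

import Mathlib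

open Finset in
lemma pp_double {α : Type*} [DecidableEq α] (m : α → ℝ) (hm : ∀ z, 0 ≤ m z) (B C : Finset α)
    (t1 t2 : α → α) (i1 : Function.Injective t1) (i2 : Function.Injective t2)
    (P : α → Prop) (hP1 : ∀ z ∈ B, P (t1 z)) (hP2 : ∀ z ∈ B, ¬ P (t2 z))
    (hC1 : ∀ z ∈ B, t1 z ∈ C) (hC2 : ∀ z ∈ B, t2 z ∈ C) :
    ∑ z ∈ B, m (t1 z) + ∑ z ∈ B, m (t2 z) ≤ ∑ z ∈ C, m z := by
  classical
  rw [← Finset.sum_image (f := m) (g := t1) (fun a _ b _ h => i1 h),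
    ← Finset.sum_image (f := m) (g := t2) (fun a _ b _ h => i2 h), ← Finset.sum_union]
  · apply Finset.sum_le_sum_of_subset_of_nonneg
    · intro z hz
      simp only [mem_union, mem_image] at hz
      rcases hz with ⟨a, ha, rfl⟩ | ⟨a, ha, rfl⟩
      · exact hC1 a ha
      · exact hC2 a ha
    · intro i _ _; exact hm i
  · rw [Finset.disjoint_left]
    intro z hz hz2
    simp only [mem_image] at hz hz2
    obtain ⟨a, ha, rfl⟩ := hz
    obtain ⟨b, hb, hb2⟩ := hz2
    exact hP2 b hb (hb2 ▸ hP1 a ha)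

open Finset in
lemma pp_single {α : Type*} [DecidableEq α] (m : α → ℝ) (hm : ∀ z, 0 ≤ m z) (B C : Finset α)
    (t1 : α → α) (i1 : Function.Injective t1) 
    (hC1 : ∀ z ∈ B, t1 z ∈ C) :
    ∑ z ∈ B, m (t1 z) ≤ ∑ z ∈ C, m z := by
  classical
  rw [← Finset.sum_image (f := m) (g := t1) (fun a _ b _ h => i1 h)]
  apply Finset.sum_le_sum_of_subset_of_nonneg
  · intro z hz
    simp only [mem_image] at hz
    rcases hz with ⟨a, ha, rfl⟩
    exact hC1 a ha
  · intro i _ _; exact hm i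

lemma vma_add {p : ℕ} [NeZero p] (x y : ZMod p) (hx : 4 * |x.valMinAbs| < p)
    (hy : 4 * |y.valMinAbs| < p) : (x + y).valMinAbs = x.valMinAbs + y.valMinAbs := by
  rw [ZMod.valMinAbs_spec]
  refine ⟨by push_cast [ZMod.coe_valMinAbs]; rfl, ?_, ?_⟩
  · have := neg_abs_le x.valMinAbs
    have := neg_abs_le y.valMinAbs
    linarith
  · have := le_abs_self x.valMinAbs
    have := le_abs_self y.valMinAbs
    linarith

lemma vma_sub {p : ℕ} [NeZero p] (x y : ZMod p) (hx : 4 * |x.valMinAbs| < p)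
    (hy : 4 * |y.valMinAbs| < p) : (x - y).valMinAbs = x.valMinAbs - y.valMinAbs := by
  rw [ZMod.valMinAbs_spec]
  refine ⟨by push_cast [ZMod.coe_valMinAbs]; rfl, ?_, ?_⟩
  · have := neg_abs_le x.valMinAbs
    have := le_abs_self y.valMinAbs
    linarith
  · have := le_abs_self x.valMinAbs
    have := neg_abs_le y.valMinAbs
    linarith

open Finset in
lemma pingpong {p : ℕ} [NeZero p] (m : ZMod p × ZMod p → ℝ) (hm : ∀ z, 0 ≤ m z) (d : ℝ)
    (h1 : ∀ B : Finset (ZMod p × ZMod p), ∑ z ∈ B, m z ≤ ∑ z ∈ B, m (z.1, z.2 + z.1) + d)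
    (h2 : ∀ B : Finset (ZMod p × ZMod p), ∑ z ∈ B, m z ≤ ∑ z ∈ B, m (z.1, z.2 - z.1) + d)
    (h3 : ∀ B : Finset (ZMod p × ZMod p), ∑ z ∈ B, m z ≤ ∑ z ∈ B, m (z.1 + z.2, z.2) + d)
    (h4 : ∀ B : Finset (ZMod p × ZMod p), ∑ z ∈ B, m z ≤ ∑ z ∈ B, m (z.1 - z.2, z.2) + d)
    (hx : ∑ z with (p : ℤ) ≤ 4 * |z.1.valMinAbs|, m z ≤ d)
    (hy : ∑ z with (p : ℤ) ≤ 4 * |z.2.valMinAbs|, m z ≤ d) :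
    ∑ z with z ≠ 0, m z ≤ 24 * d := by
  classical
  let X : ZMod p × ZMod p → ℤ := fun z => z.1.valMinAbs
  let Y : ZMod p × ZMod p → ℤ := fun z => z.2.valMinAbs
  let Q : ZMod p × ZMod p → Prop := fun z => 4 * |X z| < p ∧ 4 * |Y z| < p
  have i1 : Function.Injective (fun z : ZMod p × ZMod p => (z.1, z.2 + z.1)) := by
    rintro ⟨a, b⟩ ⟨c, e⟩ h; simp only [Prod.mk.injEq] at h ⊢
    obtain ⟨rfl, h⟩ := h; exact ⟨rfl, add_right_cancel h⟩
  have i2 : Function.Injective (fun z : ZMod p × ZMod p => (z.1, z.2 - z.1)) := by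
    rintro ⟨a, b⟩ ⟨c, e⟩ h; simp only [Prod.mk.injEq] at h ⊢
    obtain ⟨rfl, h⟩ := h; exact ⟨rfl, sub_left_injective h⟩
  have i3 : Function.Injective (fun z : ZMod p × ZMod p => (z.1 + z.2, z.2)) := by
    rintro ⟨a, b⟩ ⟨c, e⟩ h; simp only [Prod.mk.injEq] at h ⊢
    obtain ⟨h, rfl⟩ := h; exact ⟨add_right_cancel h, rfl⟩
  have i4 : Function.Injective (fun z : ZMod p × ZMod p => (z.1 - z.2, z.2)) := by
    rintro ⟨a, b⟩ ⟨c, e⟩ h; simp only [Prod.mk.injEq] at h ⊢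
    obtain ⟨h, rfl⟩ := h; exact ⟨sub_left_injective h, rfl⟩
  have v1 : ∀ z, Q z → Y (z.1, z.2 + z.1) = Y z + X z := fun z hz => vma_add _ _ hz.2 hz.1
  have v2 : ∀ z, Q z → Y (z.1, z.2 - z.1) = Y z - X z := fun z hz => vma_sub _ _ hz.2 hz.1
  have v3 : ∀ z, Q z → X (z.1 + z.2, z.2) = X z + Y z := fun z hz => vma_add _ _ hz.1 hz.2
  have v4 : ∀ z, Q z → X (z.1 - z.2, z.2) = X z - Y z := fun z hz => vma_sub _ _ hz.1 hz.2
  have x1 : ∀ z, X (z.1, z.2 + z.1) = X z := fun z => rfl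
  have x2 : ∀ z, X (z.1, z.2 - z.1) = X z := fun z => rfl
  have x3 : ∀ z, Y (z.1 + z.2, z.2) = Y z := fun z => rfl
  have x4 : ∀ z, Y (z.1 - z.2, z.2) = Y z := fun z => rfl
  have hnQ : ∑ z with ¬ Q z, m z ≤ 2 * d := by
    calc ∑ z with ¬ Q z, m z ≤ ∑ z ∈ (univ.filter (fun z : ZMod p × ZMod p => (p : ℤ) ≤ 4 * |z.1.valMinAbs|)) ∪
          (univ.filter (fun z : ZMod p × ZMod p => (p : ℤ) ≤ 4 * |z.2.valMinAbs|)), m z := by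
          apply Finset.sum_le_sum_of_subset_of_nonneg
          · intro z hz
            simp only [mem_filter, mem_univ, true_and, mem_union, Q, X, Y] at hz ⊢
            by_contra hcon; push Not at hcon; exact hz hcon
          · intro i _ _; exact hm i
      _ ≤ _ := by
        have := Finset.sum_union_inter (s₁ := (univ.filter (fun z : ZMod p × ZMod p => (p : ℤ) ≤ 4 * |z.1.valMinAbs|))) (s₂ := (univ.filter (fun z : ZMod p × ZMod p => (p : ℤ) ≤ 4 * |z.2.valMinAbs|))) (f := m)
        have h0 : 0 ≤ ∑ z ∈ (univ.filter (fun z : ZMod p × ZMod p => (p : ℤ) ≤ 4 * |z.1.valMinAbs|)) ∩ (univ.filter (fun z : ZMod p × ZMod p => (p : ℤ) ≤ 4 * |z.2.valMinAbs|)), m z := Finset.sum_nonneg (fun i _ => hm i)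
        linarith
  have split : ∀ (R : ZMod p × ZMod p → Prop) [DecidablePred R], ∑ z with R z, m z ≤ ∑ z with (Q z ∧ R z), m z + 2 * d := by
    intro R _
    calc ∑ z with R z, m z ≤ ∑ z ∈ (univ.filter (fun z => Q z ∧ R z)) ∪ (univ.filter (fun z => ¬ Q z)), m z := by
          apply Finset.sum_le_sum_of_subset_of_nonneg
          · intro z hz
            simp only [mem_filter, mem_univ, true_and, mem_union] at hz ⊢
            tauto
          · intro i _ _; exact hm i
      _ = ∑ z with (Q z ∧ R z), m z + ∑ z with ¬ Q z, m z := by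
          rw [Finset.sum_union]
          rw [Finset.disjoint_left]; intro z hz hz2
          simp only [mem_filter, mem_univ, true_and] at hz hz2; tauto
      _ ≤ _ := by linarith
  -- first quadrant
  have q1 : ∑ z with (Q z ∧ 0 < X z * Y z), m z ≤ 4 * d := by
    have a1 := h1 (univ.filter (fun z => Q z ∧ 0 < X z * Y z))
    have a3 := h3 (univ.filter (fun z => Q z ∧ 0 < X z * Y z))
    have := pp_double m hm (univ.filter (fun z => Q z ∧ 0 < X z * Y z)) (univ.filter (fun z => 0 < X z * Y z))
      _ _ i1 i3 (fun z => |X z| < |Y z|) ?_ ?_ ?_ ?_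
    · have := split (fun z => 0 < X z * Y z)
      linarith
    all_goals
      intro z hz
      simp only [mem_filter, mem_univ, true_and] at hz ⊢
      obtain ⟨hq, hz⟩ := hz
    · rw [x1, v1 z hq]
      rcases pos_and_pos_or_neg_and_neg_of_mul_pos hz with ⟨h, h'⟩ | ⟨h, h'⟩
      · rw [abs_of_pos h, abs_of_pos (by linarith)]; linarith
      · rw [abs_of_neg h, abs_of_neg (by linarith)]; linarith
    · rw [x3, v3 z hq]
      rcases pos_and_pos_or_neg_and_neg_of_mul_pos hz with ⟨h, h'⟩ | ⟨h, h'⟩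
      · rw [abs_of_pos h', abs_of_pos (by linarith)]; linarith
      · rw [abs_of_neg h', abs_of_neg (by linarith)]; linarith
    · rw [x1, v1 z hq]; nlinarith [sq_nonneg (X z)]
    · rw [x3, v3 z hq]; nlinarith [sq_nonneg (Y z)]
  have q2 : ∑ z with (Q z ∧ X z * Y z < 0), m z ≤ 4 * d := by
    have a1 := h2 (univ.filter (fun z => Q z ∧ X z * Y z < 0))
    have a3 := h4 (univ.filter (fun z => Q z ∧ X z * Y z < 0))
    have := pp_double m hm (univ.filter (fun z => Q z ∧ X z * Y z < 0)) (univ.filter (fun z => X z * Y z < 0))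
      _ _ i2 i4 (fun z => |X z| < |Y z|) ?_ ?_ ?_ ?_
    · have := split (fun z => X z * Y z < 0)
      linarith
    all_goals
      intro z hz
      simp only [mem_filter, mem_univ, true_and] at hz ⊢
      obtain ⟨hq, hz⟩ := hz
    · rw [x2, v2 z hq]
      rcases mul_neg_iff.1 hz with ⟨h, h'⟩ | ⟨h, h'⟩
      · rw [abs_of_pos h, abs_of_neg (by linarith)]; linarith
      · rw [abs_of_neg h, abs_of_pos (by linarith)]; linarith
    · rw [x4, v4 z hq]
      rcases mul_neg_iff.1 hz with ⟨h, h'⟩ | ⟨h, h'⟩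
      · rw [abs_of_neg h', abs_of_pos (by linarith)]; linarith
      · rw [abs_of_pos h', abs_of_neg (by linarith)]; linarith
    · rw [x2, v2 z hq]; nlinarith [sq_nonneg (X z)]
    · rw [x4, v4 z hq]; nlinarith [sq_nonneg (Y z)]
  have q1' := split (fun z => 0 < X z * Y z)
  have q3 : ∑ z with (Q z ∧ Y z = 0 ∧ X z ≠ 0), m z ≤ 7 * d := by
    have a1 := h1 (univ.filter (fun z => Q z ∧ Y z = 0 ∧ X z ≠ 0))
    have := pp_single m hm (univ.filter (fun z => Q z ∧ Y z = 0 ∧ X z ≠ 0)) (univ.filter (fun z => 0 < X z * Y z))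
      _ i1 ?_
    · linarith
    intro z hz
    simp only [mem_filter, mem_univ, true_and] at hz ⊢
    obtain ⟨hq, hz, hz'⟩ := hz
    rw [x1, v1 z hq, hz, zero_add]; exact mul_self_pos.2 hz'
  have q4 : ∑ z with (Q z ∧ X z = 0 ∧ Y z ≠ 0), m z ≤ 7 * d := by
    have a1 := h3 (univ.filter (fun z => Q z ∧ X z = 0 ∧ Y z ≠ 0))
    have := pp_single m hm (univ.filter (fun z => Q z ∧ X z = 0 ∧ Y z ≠ 0)) (univ.filter (fun z => 0 < X z * Y z))
      _ i3 ?_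
    · linarith
    intro z hz
    simp only [mem_filter, mem_univ, true_and] at hz ⊢
    obtain ⟨hq, hz, hz'⟩ := hz
    rw [x3, v3 z hq, hz, zero_add]; exact mul_self_pos.2 hz'
  have fin : ∑ z with z ≠ 0, m z ≤ ∑ z with (Q z ∧ 0 < X z * Y z), m z + ∑ z with (Q z ∧ X z * Y z < 0), m z
     + ∑ z with (Q z ∧ Y z = 0 ∧ X z ≠ 0), m z + ∑ z with (Q z ∧ X z = 0 ∧ Y z ≠ 0), m z + ∑ z with ¬ Q z, m z := by
    simp only [Finset.sum_filter, ← Finset.sum_add_distrib]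
    apply Finset.sum_le_sum
    intro z _
    have e : ∀ (c : Prop) [Decidable c], 0 ≤ (if c then m z else 0) := by
      intro c _; split_ifs; exacts [hm z, le_rfl]
    by_cases hz : z = 0
    · simp only [hz, ne_eq, not_true_eq_false, if_false]
      subst hz
      have := e (Q 0 ∧ 0 < X 0 * Y 0); have := e (Q 0 ∧ X 0 * Y 0 < 0)
      have := e (Q 0 ∧ Y 0 = 0 ∧ X 0 ≠ 0); have := e (Q 0 ∧ X 0 = 0 ∧ Y 0 ≠ 0); have := e (¬ Q 0)
      linarith
    rw [if_pos hz]
    have t1 := e (Q z ∧ 0 < X z * Y z); have t2 := e (Q z ∧ X z * Y z < 0)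
    have t3 := e (Q z ∧ Y z = 0 ∧ X z ≠ 0); have t4 := e (Q z ∧ X z = 0 ∧ Y z ≠ 0); have t5 := e (¬ Q z)
    by_cases hq : Q z
    · by_cases hX : X z = 0
      · by_cases hY : Y z = 0
        · exfalso; apply hz
          have a := ZMod.coe_valMinAbs z.1
          have b := ZMod.coe_valMinAbs z.2
          simp only [X, Y] at hX hY
          rw [hX] at a; rw [hY] at b
          ext <;> simp [← a, ← b]
        · rw [if_pos (⟨hq, hX, hY⟩ : Q z ∧ X z = 0 ∧ Y z ≠ 0)]; linarith
      · by_cases hY : Y z = 0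
        · rw [if_pos (⟨hq, hY, hX⟩ : Q z ∧ Y z = 0 ∧ X z ≠ 0)]; linarith
        · rcases lt_or_gt_of_ne (mul_ne_zero hX hY) with h | h
          · rw [if_pos (⟨hq, h⟩ : Q z ∧ X z * Y z < 0)]; linarith
          · rw [if_pos (⟨hq, h⟩ : Q z ∧ 0 < X z * Y z)]; linarith
    · rw [if_pos hq]; linarith
  linarith


lemma sum_char_pair {p : ℕ} [NeZero p] (a b : ZMod p) :
    ∑ z : ZMod p × ZMod p, ZMod.stdAddChar (z.1 * a + z.2 * b) = (if a = 0 ∧ b = 0 then (p : ℂ)^2 else 0) := by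
  rw [Fintype.sum_prod_type]
  simp only [AddChar.map_add_eq_mul, ← Finset.mul_sum]
  rw [← Finset.sum_mul, AddChar.sum_mulShift _ (ZMod.isPrimitive_stdAddChar p), AddChar.sum_mulShift _ (ZMod.isPrimitive_stdAddChar p)]
  by_cases ha : a = 0 <;> by_cases hb : b = 0 <;> simp [ha, hb, ZMod.card, sq]

lemma parseval_pair {p : ℕ} [NeZero p] (h : ZMod p × ZMod p → ℂ) :
    ∑ z : ZMod p × ZMod p, ‖∑ w : ZMod p × ZMod p, ZMod.stdAddChar (z.1 * w.1 + z.2 * w.2) * h w‖ ^ 2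
     = (p:ℝ)^2 * ∑ w, ‖h w‖^2 := by
  have key : ∀ a : ℂ, ((‖a‖^2 : ℝ) : ℂ) = a * (starRingEnd ℂ) a := by
    intro a; rw [Complex.mul_conj, Complex.normSq_eq_norm_sq]
  apply Complex.ofReal_injective
  rw [Complex.ofReal_sum, Complex.ofReal_mul, Complex.ofReal_sum]
  simp only [key, map_sum, map_mul, Finset.sum_mul_sum]
  rw [Finset.sum_comm]
  have : ∀ w : ZMod p × ZMod p, ∑ z : ZMod p × ZMod p, ∑ w' : ZMod p × ZMod p,
      ZMod.stdAddChar (z.1 * w.1 + z.2 * w.2) * h w * ((starRingEnd ℂ) (ZMod.stdAddChar (z.1 * w'.1 + z.2 * w'.2)) * (starRingEnd ℂ) (h w'))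
      = (p:ℂ)^2 * (h w * (starRingEnd ℂ) (h w)) := by
    intro w
    rw [Finset.sum_comm]
    have e : ∀ w' : ZMod p × ZMod p, ∑ z : ZMod p × ZMod p, 
      ZMod.stdAddChar (z.1 * w.1 + z.2 * w.2) * h w * ((starRingEnd ℂ) (ZMod.stdAddChar (z.1 * w'.1 + z.2 * w'.2)) * (starRingEnd ℂ) (h w'))
      = if w' = w then (p:ℂ)^2 * (h w * (starRingEnd ℂ) (h w)) else 0 := by
      intro w'
      have e2 : ∀ z : ZMod p × ZMod p, ZMod.stdAddChar (z.1 * w.1 + z.2 * w.2) * h w * ((starRingEnd ℂ) (ZMod.stdAddChar (z.1 * w'.1 + z.2 * w'.2)) * (starRingEnd ℂ) (h w'))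
        = ZMod.stdAddChar (z.1 * (w.1 - w'.1) + z.2 * (w.2 - w'.2)) * (h w * (starRingEnd ℂ) (h w')) := by
        intro z
        rw [← AddChar.map_neg_eq_conj]
        have : z.1 * (w.1 - w'.1) + z.2 * (w.2 - w'.2) = (z.1 * w.1 + z.2 * w.2) + -(z.1 * w'.1 + z.2 * w'.2) := by ring
        rw [this, AddChar.map_add_eq_mul _ (z.1 * w.1 + z.2 * w.2)]; ring
      simp only [e2]
      rw [← Finset.sum_mul, sum_char_pair]
      by_cases hw : w' = w
      · subst hw; simp
      · rw [if_neg hw, if_neg, zero_mul]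
        rintro ⟨h1, h2⟩; apply hw
        ext
        · exact (sub_eq_zero.1 h1).symm
        · exact (sub_eq_zero.1 h2).symm
    simp only [e]
    simp
  simp only [this, Finset.mul_sum]
  simp

section
variable {G : Type} [Group G] [Fintype G] {p : ℕ} [NeZero p]

noncomputable def FT (u : ZMod p → ZMod p → G) (f : G → ℝ) (z : ZMod p × ZMod p) (g : G) : ℂ :=
  ∑ w : ZMod p × ZMod p, ZMod.stdAddChar (z.1 * w.1 + z.2 * w.2) * (f (u w.1 w.2 * g) : ℂ)

noncomputable def mu (u : ZMod p → ZMod p → G) (f : G → ℝ) (z : ZMod p × ZMod p) : ℝ :=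
  (∑ g, ‖FT u f z g‖^2) / (p:ℝ)^4

lemma mu_nonneg (u : ZMod p → ZMod p → G) (f : G → ℝ) (z : ZMod p × ZMod p) : 0 ≤ mu u f z := by
  unfold mu; positivity

lemma mu_total (u : ZMod p → ZMod p → G) (f : G → ℝ) : ∑ z, mu u f z = ∑ g, f g ^ 2 := by
  unfold mu
  rw [← Finset.sum_div, Finset.sum_comm]
  unfold FT
  have hp : (p:ℝ) ≠ 0 := by exact_mod_cast NeZero.ne p
  have : ∀ g, ∑ z : ZMod p × ZMod p, ‖∑ w : ZMod p × ZMod p, ZMod.stdAddChar (z.1 * w.1 + z.2 * w.2) * (f (u w.1 w.2 * g) : ℂ)‖^2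
    = (p:ℝ)^2 * ∑ w : ZMod p × ZMod p, f (u w.1 w.2 * g)^2 := by
    intro g
    rw [parseval_pair (fun w => (f (u w.1 w.2 * g) : ℂ))]
    simp
  simp only [this]
  rw [← Finset.mul_sum, Finset.sum_comm]
  have : ∀ w : ZMod p × ZMod p, ∑ g, f (u w.1 w.2 * g)^2 = ∑ g, f g ^ 2 := by
    intro w
    exact Equiv.sum_comp (Equiv.mulLeft (u w.1 w.2)) (fun g => f g ^ 2)
  simp only [this, Finset.sum_const, Finset.card_univ, Fintype.card_prod, ZMod.card]
  rw [div_eq_iff (by positivity)]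
  simp; ring

/-- shift by translation -/
lemma FT_u (u : ZMod p → ZMod p → G) (hu : ∀ s t s' t', u (s + s') (t + t') = u s t * u s' t')
    (f : G → ℝ) (s t : ZMod p) (z : ZMod p × ZMod p) (g : G) :
    FT u (fun g => f (u s t * g)) z g = ZMod.stdAddChar (-(z.1 * s + z.2 * t)) * FT u f z g := by
  unfold FT
  rw [Finset.mul_sum]
  symm
  rw [← Equiv.sum_comp (Equiv.addLeft ((s,t) : ZMod p × ZMod p))]
  symm
  apply Finset.sum_congr rfl
  intro w _
  simp only [Equiv.coe_addLeft, Prod.fst_add, Prod.snd_add]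
  rw [hu, ← mul_assoc, ← mul_assoc, ← AddChar.map_add_eq_mul]
  congr 2
  ring

lemma FT_a (u : ZMod p → ZMod p → G) (a : G) (ha : ∀ s t, a * u s t = u (s + t) t * a)
    (f : G → ℝ) (z : ZMod p × ZMod p) (g : G) :
    FT u (fun g => f (a * g)) z g = FT u f (z.1, z.2 - z.1) (a * g) := by
  unfold FT
  let e : ZMod p × ZMod p ≃ ZMod p × ZMod p := 
    { toFun := fun w => (w.1 + w.2, w.2), invFun := fun w => (w.1 - w.2, w.2)
      left_inv := by intro w; simp
      right_inv := by intro w; simp }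
  symm
  rw [← Equiv.sum_comp e]
  symm
  apply Finset.sum_congr rfl
  intro w _
  simp only [e, Equiv.coe_fn_mk]
  rw [← mul_assoc a, ha, mul_assoc]
  congr 2
  ring

lemma FT_b (u : ZMod p → ZMod p → G) (a : G) (ha : ∀ s t, a * u s t = u s (s + t) * a)
    (f : G → ℝ) (z : ZMod p × ZMod p) (g : G) :
    FT u (fun g => f (a * g)) z g = FT u f (z.1 - z.2, z.2) (a * g) := by
  unfold FT
  let e : ZMod p × ZMod p ≃ ZMod p × ZMod p := 
    { toFun := fun w => (w.1, w.1 + w.2), invFun := fun w => (w.1, w.2 - w.1)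
      left_inv := by intro w; simp
      right_inv := by intro w; simp }
  symm
  rw [← Equiv.sum_comp e]
  symm
  apply Finset.sum_congr rfl
  intro w _
  simp only [e, Equiv.coe_fn_mk]
  rw [← mul_assoc a, ha, mul_assoc]
  congr 2
  ring

lemma mu_a (u : ZMod p → ZMod p → G) (a : G) (ha : ∀ s t, a * u s t = u (s + t) t * a)
    (f : G → ℝ) (z : ZMod p × ZMod p) :
    mu u (fun g => f (a * g)) z = mu u f (z.1, z.2 - z.1) := by
  unfold mu
  simp only [FT_a u a ha]
  congr 1
  exact Equiv.sum_comp (Equiv.mulLeft a) (fun g => ‖FT u f (z.1, z.2 - z.1) g‖^2)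

lemma mu_b (u : ZMod p → ZMod p → G) (a : G) (ha : ∀ s t, a * u s t = u s (s + t) * a)
    (f : G → ℝ) (z : ZMod p × ZMod p) :
    mu u (fun g => f (a * g)) z = mu u f (z.1 - z.2, z.2) := by
  unfold mu
  simp only [FT_b u a ha]
  congr 1
  exact Equiv.sum_comp (Equiv.mulLeft a) (fun g => ‖FT u f (z.1 - z.2, z.2) g‖^2)

lemma FT_sub (u : ZMod p → ZMod p → G) (f f' : G → ℝ) (z : ZMod p × ZMod p) (g : G) :
    FT u (fun g => f g - f' g) z g = FT u f z g - FT u f' z g := by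
  unfold FT
  rw [← Finset.sum_sub_distrib]
  apply Finset.sum_congr rfl; intro w _; push_cast; ring

lemma mu_u (u : ZMod p → ZMod p → G) (hu : ∀ s t s' t', u (s + s') (t + t') = u s t * u s' t')
    (f : G → ℝ) (s t : ZMod p) (z : ZMod p × ZMod p) :
    mu u (fun g => f (u s t * g) - f g) z = ‖(ZMod.stdAddChar (-(z.1 * s + z.2 * t)) : ℂ) - 1‖^2 * mu u f z := by
  unfold mu
  rw [mul_div_assoc', Finset.mul_sum]
  congr 1
  apply Finset.sum_congr rfl; intro g _
  rw [FT_sub, FT_u u hu, ← mul_pow, ← norm_mul]; congr 2; ring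

lemma mu_le (u : ZMod p → ZMod p → G) (f f' : G → ℝ) (e : ℝ) (he : 0 < e) (z : ZMod p × ZMod p) :
    mu u f z ≤ (1 + e) * mu u f' z + (1 + 1/e) * mu u (fun g => f g - f' g) z := by
  unfold mu
  rw [mul_div_assoc', mul_div_assoc', ← add_div, Finset.mul_sum, Finset.mul_sum, ← Finset.sum_add_distrib]
  apply div_le_div_of_nonneg_right _ (by positivity)
  apply Finset.sum_le_sum; intro g _
  rw [FT_sub]
  set x := FT u f z g
  set y := FT u f' z g
  have h1 : ‖x‖ ≤ ‖y‖ + ‖x - y‖ := by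
    calc ‖x‖ = ‖y + (x - y)‖ := by congr 1; ring
      _ ≤ _ := norm_add_le _ _
  have h2 : ‖x‖^2 ≤ (‖y‖ + ‖x - y‖)^2 := by gcongr
  refine h2.trans ?_
  have : (1 + e) * ‖y‖^2 + (1 + 1/e) * ‖x - y‖^2 - (‖y‖ + ‖x - y‖)^2 = (e * ‖y‖ - ‖x-y‖)^2 / e := by
    field_simp; ring
  have h3 : 0 ≤ (e * ‖y‖ - ‖x-y‖)^2 / e := by positivity
  linarith

lemma mu_le_sum (u : ZMod p → ZMod p → G) (f f' : G → ℝ) (e : ℝ) (he : 0 < e) (he1 : e ≤ 1)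
    (hf : ∑ g, (f g - f' g)^2 ≤ e^2 * ∑ g, f g^2) (hff : ∑ g, f' g^2 = ∑ g, f g^2)
    (B : Finset (ZMod p × ZMod p)) :
    ∑ z ∈ B, mu u f z ≤ ∑ z ∈ B, mu u f' z + 4 * e * ∑ g, f g^2 := by
  have hN : 0 ≤ ∑ g, f g^2 := Finset.sum_nonneg (fun _ _ => sq_nonneg _)
  have h1 : ∑ z ∈ B, mu u f z ≤ ∑ z ∈ B, ((1 + e) * mu u f' z + (1 + 1/e) * mu u (fun g => f g - f' g) z) :=
    Finset.sum_le_sum (fun z _ => mu_le u f f' e he z)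
  rw [Finset.sum_add_distrib, ← Finset.mul_sum, ← Finset.mul_sum] at h1
  have hB : ∀ h : G → ℝ, ∑ z ∈ B, mu u h z ≤ ∑ g, h g^2 := by
    intro h; rw [← mu_total u h]
    exact Finset.sum_le_sum_of_subset_of_nonneg (Finset.subset_univ _) (fun _ _ _ => mu_nonneg _ _ _)
  have h2 := hB f'
  have h3 := (hB (fun g => f g - f' g)).trans hf
  rw [hff] at h2
  have h4 : (1 + 1/e) * ∑ z ∈ B, mu u (fun g => f g - f' g) z ≤ (1 + 1/e) * (e^2 * ∑ g, f g^2) := by gcongr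
  have h5 : (1 + 1/e) * (e^2 * ∑ g, f g^2) = (e^2 + e) * ∑ g, f g^2 := by field_simp
  have h6 : e^2 * ∑ g, f g^2 ≤ e * ∑ g, f g^2 := by gcongr; nlinarith
  nlinarith

lemma char_far (x : ZMod p) (hx : (p:ℤ) ≤ 4 * |x.valMinAbs|) : 2 ≤ ‖(ZMod.stdAddChar (-x) : ℂ) - 1‖^2 := by
  have hp : (0:ℝ) < p := by exact_mod_cast NeZero.pos p
  have h1 := ZMod.valMinAbs_mem_Ioc x
  obtain ⟨h1, h2⟩ := h1
  set k := x.valMinAbs with hk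
  have hxk : -x = ((-k : ℤ) : ZMod p) := by rw [hk]; push_cast [ZMod.coe_valMinAbs]; rfl
  rw [hxk, ZMod.stdAddChar_coe]
  have e1 : (2 * (Real.pi:ℂ) * Complex.I * ((-k : ℤ):ℂ) / (p:ℂ)) = ((-(2 * Real.pi * k / p) : ℝ) : ℂ) * Complex.I := by
    push_cast; ring
  rw [e1, ← Complex.normSq_eq_norm_sq, Complex.normSq_apply]
  simp only [Complex.sub_re, Complex.sub_im, Complex.one_re, Complex.one_im, Complex.exp_ofReal_mul_I_re, Complex.exp_ofReal_mul_I_im]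
  set θ := 2 * Real.pi * k / p
  have hcos : Real.cos (-θ) ≤ 0 := by
    rw [Real.cos_neg, ← Real.cos_abs]
    have habs : |θ| = 2 * Real.pi * |(k:ℝ)| / p := by
      simp only [θ, abs_div, abs_mul, abs_of_pos hp, abs_of_pos Real.pi_pos]; norm_num
    have hka : (p:ℝ) ≤ 4 * |(k:ℝ)| := by exact_mod_cast hx
    have hkb : |(k:ℝ)| * 2 ≤ p := by
      have : |k| * 2 ≤ p := by
        rcases abs_cases k with ⟨h, _⟩ | ⟨h, _⟩ <;> rw [h] <;> linarith
      exact_mod_cast this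
    apply Real.cos_nonpos_of_pi_div_two_le_of_le
    · rw [habs, le_div_iff₀ hp]; nlinarith [Real.pi_pos]
    · rw [habs, div_le_iff₀ hp]; nlinarith [Real.pi_pos]
  nlinarith [Real.cos_sq_add_sin_sq (-θ)]

theorem relT (u : ZMod p → ZMod p → G) (hu : ∀ s t s' t', u (s + s') (t + t') = u s t * u s' t')
    (a b : G) (ha : ∀ s t, a * u s t = u (s + t) t * a) (hb : ∀ s t, b * u s t = u s (s + t) * b)
    (f : G → ℝ) (e : ℝ) (he : 0 < e) (he1 : e ≤ 1)
    (hfa : ∑ g, (f (a * g) - f g)^2 ≤ e^2 * ∑ g, f g^2)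
    (hfb : ∑ g, (f (b * g) - f g)^2 ≤ e^2 * ∑ g, f g^2)
    (hf1 : ∑ g, (f (u 1 0 * g) - f g)^2 ≤ e^2 * ∑ g, f g^2)
    (hf2 : ∑ g, (f (u 0 1 * g) - f g)^2 ≤ e^2 * ∑ g, f g^2) (s t : ZMod p) :
    ∑ g, (f (u s t * g) - f g)^2 ≤ 400 * e * ∑ g, f g^2 := by
  have hN : 0 ≤ ∑ g, f g^2 := Finset.sum_nonneg (fun _ _ => sq_nonneg _)
  have inv : ∀ c : G, ∑ g, f (c * g)^2 = ∑ g, f g^2 := fun c => Equiv.sum_comp (Equiv.mulLeft c) (fun g => f g ^ 2)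
  have sy : ∀ c : G, ∑ g, (f g - f (c * g))^2 = ∑ g, (f (c * g) - f g)^2 := by
    intro c; apply Finset.sum_congr rfl; intro g _; ring
  have far : ∀ (s t : ZMod p), ∑ g, (f (u s t * g) - f g)^2 ≤ e^2 * ∑ g, f g^2 →
     ∑ z with (p:ℤ) ≤ 4 * |(z.1 * s + z.2 * t).valMinAbs|, mu u f z ≤ 4 * e * ∑ g, f g ^ 2 := by
    intro s t h
    rw [← mu_total u (fun g => f (u s t * g) - f g)] at h
    simp only [mu_u u hu] at h
    have h1 : ∑ z with (p:ℤ) ≤ 4 * |(z.1 * s + z.2 * t).valMinAbs|, 2 * mu u f z ≤ ∑ z : ZMod p × ZMod p, ‖(ZMod.stdAddChar (-(z.1 * s + z.2 * t)) : ℂ) - 1‖^2 * mu u f z := by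
      rw [Finset.sum_filter]
      apply Finset.sum_le_sum
      intro z _
      split_ifs with hz
      · exact mul_le_mul_of_nonneg_right (char_far _ hz) (mu_nonneg _ _ _)
      · exact mul_nonneg (sq_nonneg _) (mu_nonneg _ _ _)
    rw [← Finset.mul_sum] at h1
    have h6 : e^2 * ∑ g, f g^2 ≤ e * ∑ g, f g^2 := by gcongr; nlinarith
    nlinarith
  have pp := pingpong (mu u f) (mu_nonneg u f) (4 * e * ∑ g, f g^2) ?_ ?_ ?_ ?_ ?_ ?_
  · rw [← mu_total u (fun g => f (u s t * g) - f g)]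
    simp only [mu_u u hu]
    have : ∑ z : ZMod p × ZMod p, ‖(ZMod.stdAddChar (-(z.1 * s + z.2 * t)) : ℂ) - 1‖^2 * mu u f z ≤ ∑ z with z ≠ 0, 4 * mu u f z := by
      rw [Finset.sum_filter]
      apply Finset.sum_le_sum
      intro z _
      split_ifs with hz
      · apply mul_le_mul_of_nonneg_right _ (mu_nonneg _ _ _)
        have : ‖(ZMod.stdAddChar (-(z.1 * s + z.2 * t)) : ℂ) - 1‖ ≤ 2 := by
          refine (norm_sub_le _ _).trans ?_
          rw [AddChar.norm_apply]; norm_num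
        nlinarith [norm_nonneg ((ZMod.stdAddChar (-(z.1 * s + z.2 * t)) : ℂ) - 1)]
      · have : z = 0 := not_not.1 hz
        subst this; simp
    rw [← Finset.mul_sum] at this
    have : 0 ≤ e * ∑ g, f g^2 := by positivity
    linarith
  · intro B
    have h := mu_le_sum u (fun g => f (a * g)) f e he he1 (by rw [inv]; exact hfa) (inv a).symm
      (B.image (fun z => (z.1, z.2 + z.1)))
    have i1 : Function.Injective (fun z : ZMod p × ZMod p => (z.1, z.2 + z.1)) := by
      rintro ⟨a, b⟩ ⟨c, e⟩ h; simp only [Prod.mk.injEq] at h ⊢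
      obtain ⟨rfl, h⟩ := h; exact ⟨rfl, add_right_cancel h⟩
    rw [Finset.sum_image (fun a _ b _ h => i1 h), Finset.sum_image (fun a _ b _ h => i1 h), inv] at h
    simpa only [mu_a u a ha, add_sub_cancel_right] using h
  · intro B
    have h := mu_le_sum u f (fun g => f (a * g)) e he he1 (by rw [sy]; exact hfa) (inv a) B
    simpa only [mu_a u a ha] using h
  · intro B
    have h := mu_le_sum u (fun g => f (b * g)) f e he he1 (by rw [inv]; exact hfb) (inv b).symm
      (B.image (fun z => (z.1 + z.2, z.2)))
    have i1 : Function.Injective (fun z : ZMod p × ZMod p => (z.1 + z.2, z.2)) := by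
      rintro ⟨a, b⟩ ⟨c, e⟩ h; simp only [Prod.mk.injEq] at h ⊢
      obtain ⟨h, rfl⟩ := h; exact ⟨add_right_cancel h, rfl⟩
    rw [Finset.sum_image (fun a _ b _ h => i1 h), Finset.sum_image (fun a _ b _ h => i1 h), inv] at h
    simpa only [mu_b u b hb, add_sub_cancel_right] using h
  · intro B
    have h := mu_le_sum u f (fun g => f (b * g)) e he he1 (by rw [sy]; exact hfb) (inv b) B
    simpa only [mu_b u b hb] using h
  · simpa using far 1 0 hf1
  · simpa using far 0 1 hf2
end


abbrev SL3 (p : ℕ) := Matrix.SpecialLinearGroup (Fin 3) (ZMod p)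

abbrev EE {p : ℕ} {i j : Fin 3} (h : i ≠ j) (x : ZMod p) : SL3 p :=
  Matrix.SpecialLinearGroup.transvection h x

lemma EE_mul_apply {p : ℕ} {i j : Fin 3} (h : i ≠ j) (x : ZMod p) (g : SL3 p) (k l : Fin 3) :
    (EE h x * g) k l = g k l + if k = i then x * g j l else 0 := by
  change (Matrix.transvection i j x * g.1) k l = g.1 k l + _
  by_cases hk : k = i
  · subst hk; simp
  · rw [Matrix.transvection_mul_apply_of_ne _ _ _ _ hk, if_neg hk, add_zero]

lemma mul_EE_apply {p : ℕ} {i j : Fin 3} (h : i ≠ j) (x : ZMod p) (g : SL3 p) (k l : Fin 3) :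
    (g * EE h x) k l = g k l + if l = j then x * g k i else 0 := by
  change (g.1 * Matrix.transvection i j x) k l = g.1 k l + _
  by_cases hk : l = j
  · subst hk; simp
  · rw [Matrix.mul_transvection_apply_of_ne _ _ _ _ hk, if_neg hk, add_zero]

lemma one_SL_apply {p : ℕ} (k l : Fin 3) : (1 : SL3 p) k l = if k = l then 1 else 0 := by
  change (1 : Matrix _ _ _) k l = _
  rw [Matrix.one_apply]

lemma EE_inv {p : ℕ} {i j : Fin 3} (h : i ≠ j) (x : ZMod p) : EE h (-x) * EE h x = 1 := by
  ext k l
  rw [EE_mul_apply, ← mul_one (EE h x), EE_mul_apply, EE_mul_apply, one_SL_apply, one_SL_apply]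
  by_cases hk : k = i
  · subst hk; simp [h.symm]; split_ifs <;> ring
  · simp [hk]

section
variable {p : ℕ} [Fact p.Prime] (D : SL3 p → ℝ) (η : ℝ)
  (hmul : ∀ g h, D (g * h) ≤ D g + D h)
  (hE : ∀ (i j : Fin 3) (h : i ≠ j) (x : ZMod p), D (EE h x) ≤ η)
include hmul hE

lemma D_left {i j : Fin 3} (h : i ≠ j) (x : ZMod p) (g : SL3 p) (k : ℝ) (hD : D (EE h x * g) ≤ k) :
    D g ≤ k + η := by
  have h1 : g = EE h (-x) * (EE h x * g) := by rw [← mul_assoc, EE_inv, one_mul]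
  rw [h1]
  have := hmul (EE h (-x)) (EE h x * g)
  have := hE i j h (-x)
  linarith

lemma D_right {i j : Fin 3} (h : i ≠ j) (x : ZMod p) (g : SL3 p) (k : ℝ) (hD : D (g * EE h x) ≤ k) :
    D g ≤ k + η := by
  have h1 : g = (g * EE h x) * EE h (-x) := by
    have := EE_inv h (-x); rw [neg_neg] at this
    rw [mul_assoc, this, mul_one]
  rw [h1]
  have := hmul (g * EE h x) (EE h (-x))
  have := hE i j h (-x)
  linarith

lemma bg3a (g : SL3 p) (h00 : g 0 0 = 1) (h01 : g 0 1 = 0) (h02 : g 0 2 = 0) (h10 : g 1 0 = 0) (h20 : g 2 0 = 0)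
    (h21 : g 2 1 ≠ 0) : D g ≤ 3 * η := by
  have hd := g.2
  rw [Matrix.det_fin_three] at hd
  have e : g = EE (show (1 : Fin 3) ≠ 2 by decide) ((g 1 1 - 1) / g 2 1) * (EE (show (2 : Fin 3) ≠ 1 by decide) (g 2 1)
      * (EE (show (1 : Fin 3) ≠ 2 by decide) ((g 2 2 - 1) / g 2 1) * 1)) := by
    change g.1 0 0 = 1 at h00
    change g.1 0 1 = 0 at h01
    change g.1 0 2 = 0 at h02
    change g.1 1 0 = 0 at h10
    change g.1 2 0 = 0 at h20
    rw [h00, h01, h02, h10, h20] at hd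
    ext k l
    simp only [EE_mul_apply, one_SL_apply]
    change g.1 2 1 ≠ 0 at h21
    fin_cases k <;> fin_cases l <;> simp [h00, h01, h02, h10, h20] <;> field_simp <;> first | ring1 | linear_combination (-1 : ZMod p) * hd
  rw [e]
  have a1 := hmul (EE (show (1 : Fin 3) ≠ 2 by decide) ((g 1 1 - 1) / g 2 1)) (EE (show (2 : Fin 3) ≠ 1 by decide) (g 2 1)
      * (EE (show (1 : Fin 3) ≠ 2 by decide) ((g 2 2 - 1) / g 2 1) * 1))
  have a2 := hmul (EE (show (2 : Fin 3) ≠ 1 by decide) (g 2 1)) (EE (show (1 : Fin 3) ≠ 2 by decide) ((g 2 2 - 1) / g 2 1) * 1)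
  have a3 := hE 1 2 (by decide) ((g 1 1 - 1) / g 2 1)
  have a4 := hE 2 1 (by decide) (g 2 1)
  have a5 := hE 1 2 (by decide) ((g 2 2 - 1) / g 2 1)
  rw [mul_one] at *
  linarith

lemma bg3 (hη : 0 ≤ η) (g : SL3 p) (h00 : g 0 0 = 1) (h01 : g 0 1 = 0) (h02 : g 0 2 = 0) (h10 : g 1 0 = 0) (h20 : g 2 0 = 0) :
    D g ≤ 4 * η := by
  by_cases h21 : g 2 1 = 0
  · have : D g ≤ 3 * η + η := by
      refine D_left D η hmul hE (show (2 : Fin 3) ≠ 1 by decide) 1 g _ (bg3a D η hmul hE _ ?_ ?_ ?_ ?_ ?_ ?_)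
      all_goals rw [EE_mul_apply]
      · simpa using h00
      · simpa using h01
      · simpa using h02
      · simpa using h10
      · simp [h10, h20]
      · simp only [h21, if_true, one_mul, zero_add]
        intro h11
        have hd := g.2
        rw [Matrix.det_fin_three] at hd
        change g.1 0 1 = 0 at h01
        change g.1 0 2 = 0 at h02
        change g.1 2 1 = 0 at h21
        change g.1 1 1 = 0 at h11
        rw [h01, h02, h21, h11] at hd
        simp at hd
    linarith
  · have := bg3a D η hmul hE g h00 h01 h02 h10 h20 h21
    linarith

lemma bg2 (hη : 0 ≤ η) (g : SL3 p) (h00 : g 0 0 = 1) (h10 : g 1 0 = 0) (h20 : g 2 0 = 0) :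
    D g ≤ 6 * η := by
  have : D g ≤ 4 * η + η + η := by
    refine D_right D η hmul hE (show (0 : Fin 3) ≠ 1 by decide) (-g 0 1) g _ 
      (D_right D η hmul hE (show (0 : Fin 3) ≠ 2 by decide) (-g 0 2) _ _ (bg3 D η hmul hE hη _ ?_ ?_ ?_ ?_ ?_))
    all_goals simp [mul_EE_apply, h00, h10, h20]
  linarith

lemma bg1 (hη : 0 ≤ η) (g : SL3 p) (h00 : g 0 0 = 1) : D g ≤ 8 * η := by
  have : D g ≤ 6 * η + η + η := by
    refine D_left D η hmul hE (show (1 : Fin 3) ≠ 0 by decide) (-g 1 0) g _ 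
      (D_left D η hmul hE (show (2 : Fin 3) ≠ 0 by decide) (-g 2 0) _ _ (bg2 D η hmul hE hη _ ?_ ?_ ?_))
    all_goals simp [EE_mul_apply, h00]
  linarith

lemma bg0 (hη : 0 ≤ η) (g : SL3 p) (h : g 2 0 ≠ 0) : D g ≤ 9 * η := by
  have : D g ≤ 8 * η + η := by
    refine D_left D η hmul hE (show (0 : Fin 3) ≠ 2 by decide) ((1 - g 0 0) / g 2 0) g _ (bg1 D η hmul hE hη _ ?_)
    rw [EE_mul_apply]; simp only [if_true]
    field_simp; ring
  linarith

lemma bg0' (hη : 0 ≤ η) (g : SL3 p) (h : g 1 0 ≠ 0) : D g ≤ 9 * η := by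
  have : D g ≤ 8 * η + η := by
    refine D_left D η hmul hE (show (0 : Fin 3) ≠ 1 by decide) ((1 - g 0 0) / g 1 0) g _ (bg1 D η hmul hE hη _ ?_)
    rw [EE_mul_apply]; simp only [if_true]
    field_simp; ring
  linarith

lemma bg (hη : 0 ≤ η) (g : SL3 p) : D g ≤ 10 * η := by
  by_cases h2 : g 2 0 = 0
  · by_cases h1 : g 1 0 = 0
    · have : D g ≤ 9 * η + η := by
        refine D_left D η hmul hE (show (2 : Fin 3) ≠ 0 by decide) 1 g _ (bg0 D η hmul hE hη _ ?_)
        rw [EE_mul_apply]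
        simp only [h2, if_true, one_mul, zero_add]
        intro h0
        have hd := g.2
        rw [Matrix.det_fin_three] at hd
        change g.1 2 0 = 0 at h2
        change g.1 1 0 = 0 at h1
        change g.1 0 0 = 0 at h0
        rw [h0, h1, h2] at hd
        simp at hd
      linarith
    · have := bg0' D η hmul hE hη g h1; linarith
  · have := bg0 D η hmul hE hη g h2; linarith
end


section
variable {G : Type} [Fintype G]

noncomputable def nr (f : G → ℝ) : ℝ := Real.sqrt (∑ g, f g ^ 2)

lemma nr_eq (f : G → ℝ) : nr f = ‖(WithLp.toLp 2 f : EuclideanSpace ℝ G)‖ := by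
  rw [EuclideanSpace.norm_eq]; simp [nr]

lemma nr_nonneg (f : G → ℝ) : 0 ≤ nr f := Real.sqrt_nonneg _

lemma nr_sq (f : G → ℝ) : nr f ^ 2 = ∑ g, f g ^ 2 :=
  Real.sq_sqrt (Finset.sum_nonneg (fun _ _ => sq_nonneg _))

lemma nr_add (f h : G → ℝ) : nr (fun x => f x + h x) ≤ nr f + nr h := by
  rw [nr_eq, nr_eq, nr_eq]
  exact norm_add_le (WithLp.toLp 2 f : EuclideanSpace ℝ G) (WithLp.toLp 2 h)

lemma nr_smul (c : ℝ) (f : G → ℝ) : nr (fun x => c * f x) = |c| * nr f := by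
  rw [nr_eq, nr_eq, ← Real.norm_eq_abs, ← norm_smul]
  rfl

lemma nr_sum {ι : Type*} (s : Finset ι) (f : ι → G → ℝ) : nr (fun x => ∑ i ∈ s, f i x) ≤ ∑ i ∈ s, nr (f i) := by
  simp only [nr_eq]
  have : (WithLp.toLp 2 (fun x => ∑ i ∈ s, f i x) : EuclideanSpace ℝ G) = ∑ i ∈ s, WithLp.toLp 2 (f i) := by
    ext x; simp
  rw [this]
  exact norm_sum_le _ _

lemma nr_le_of_sq (f : G → ℝ) (c : ℝ) (hc : 0 ≤ c) (h : ∑ g, f g ^ 2 ≤ c ^ 2) : nr f ≤ c := by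
  unfold nr
  exact (Real.sqrt_le_left hc).2 h

variable [Group G]

lemma nr_shift (f : G → ℝ) (a : G) : nr (fun x => f (a * x)) = nr f := by
  unfold nr
  congr 1
  exact Equiv.sum_comp (Equiv.mulLeft a) (fun g => f g ^ 2)

end

lemma gap_core {p : ℕ} [Fact p.Prime] [Fintype (SL3 p)] (f : SL3 p → ℝ) (hf : ∑ g, f g = 0)
    (h : ∀ (i j : Fin 3) (hij : i ≠ j), nr (fun x => f (EE hij 1 * x) - f x) ≤ 1/50000 * nr f) : nr f = 0 := by
  have hE : ∀ (i j : Fin 3) (hij : i ≠ j) (s : ZMod p), nr (fun x => f (EE hij s * x) - f x) ≤ (9/100) * nr f := by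
    intro i j hij s
    obtain ⟨k, hki, hkj⟩ : ∃ k : Fin 3, k ≠ i ∧ k ≠ j := by revert i j; decide
    have sqh : ∀ (i j : Fin 3) (hij : i ≠ j), ∑ x, (f (EE hij 1 * x) - f x)^2 ≤ (1/50000)^2 * ∑ x, f x ^2 := by
      intro i j hij
      rw [← nr_sq, ← nr_sq, ← mul_pow]
      exact pow_le_pow_left₀ (nr_nonneg _) (h i j hij) 2
    have zero : ∀ (i j : Fin 3) (hij : i ≠ j), (EE hij (0 : ZMod p)) = 1 := fun i j hij => 
      Matrix.SpecialLinearGroup.transvection_coeff_zero hij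
    have key := relT (G := SL3 p) (p := p) (fun s t => EE hij s * EE hkj t) ?_ (EE hki.symm 1) (EE hki 1) ?_ ?_ f
      (1/50000) (by norm_num) (by norm_num) (sqh _ _ _) (sqh _ _ _) 
      (by simpa only [zero, mul_one] using sqh _ _ _) (by simpa only [zero, one_mul] using sqh _ _ _) s 0
    · simp only [zero, mul_one] at key
      apply nr_le_of_sq _ _ (by have := nr_nonneg f; positivity)
      rw [mul_pow, nr_sq]
      refine key.trans ?_
      have : 0 ≤ ∑ g, f g ^ 2 := Finset.sum_nonneg (fun _ _ => sq_nonneg _)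
      nlinarith
    · intro s t s' t'
      ext a b
      rw [← mul_one (EE hij s * EE hkj t * _), ← mul_one (EE hij (s + s') * _)]
      simp only [mul_assoc, EE_mul_apply, one_SL_apply]
      by_cases h1 : a = i
      · subst h1; simp [hki, hij, hij.symm, hki.symm, hkj, hkj.symm]; split_ifs <;> ring
      · by_cases h2 : a = k
        · subst h2; simp [hki, hij, hij.symm, hki.symm, hkj, hkj.symm]; split_ifs <;> ring
        · simp [h1, h2]
    · intro s t
      ext a b
      rw [← mul_one (EE hki.symm 1 * _), ← mul_one (EE hij (s + t) * _ * _)]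
      simp only [mul_assoc, EE_mul_apply, one_SL_apply]
      by_cases h1 : a = i
      · subst h1; simp [hki, hij, hij.symm, hki.symm, hkj, hkj.symm]; split_ifs <;> ring
      · by_cases h2 : a = k
        · subst h2; simp [hki, hij, hij.symm, hki.symm, hkj, hkj.symm]
        · simp [h1, h2]
    · intro s t
      ext a b
      rw [← mul_one (EE hki 1 * _), ← mul_one (EE hij s * _ * _)]
      simp only [mul_assoc, EE_mul_apply, one_SL_apply]
      by_cases h1 : a = i
      · subst h1; simp [hki, hij, hij.symm, hki.symm, hkj, hkj.symm]
      · by_cases h2 : a = k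
        · subst h2; simp [hki, hij, hij.symm, hki.symm, hkj, hkj.symm]; split_ifs <;> ring
        · simp [h1, h2]
  have hmul : ∀ a b : SL3 p, nr (fun x => f (a * b * x) - f x) ≤ nr (fun x => f (a * x) - f x) + nr (fun x => f (b * x) - f x) := by
    intro a b
    rw [← nr_shift (fun x => f (a * x) - f x) b]
    refine le_trans (le_of_eq ?_) (nr_add _ _)
    congr 1; ext x; rw [mul_assoc]; ring
  have all := bg (fun a => nr (fun x => f (a * x) - f x)) ((9/100) * nr f) hmul hE (by have := nr_nonneg f; positivity)
  have avg : (Fintype.card (SL3 p) : ℝ) * nr f ≤ (Fintype.card (SL3 p) : ℝ) * (9/10 * nr f) := by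
    have e1 : (fun x => ∑ a : SL3 p, (f (a * x) - f x)) = (fun x => (-(Fintype.card (SL3 p) : ℝ)) * f x) := by
      ext x
      rw [Finset.sum_sub_distrib]
      have : ∑ a, f (a * x) = ∑ a, f a := Equiv.sum_comp (Equiv.mulRight x) f
      rw [this, hf]; simp
    have e2 := nr_sum Finset.univ (fun (a : SL3 p) x => f (a * x) - f x)
    rw [e1, nr_smul, abs_neg, Nat.abs_cast] at e2
    refine e2.trans ?_
    refine (Finset.sum_le_card_nsmul _ _ (9/10 * nr f) ?_).trans ?_
    · intro a _; have := all a; linarith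
    · simp
  have hc : (0:ℝ) < Fintype.card (SL3 p) := by exact_mod_cast Fintype.card_pos
  have := le_of_mul_le_mul_left avg hc
  have := nr_nonneg f
  linarith

def gens (p : ℕ) (i : Fin 3 × Fin 3) : SL3 p := if h : i.1 ≠ i.2 then EE h 1 else 1

lemma gap_gens {p : ℕ} [Fact p.Prime] [Fintype (SL3 p)] (f : SL3 p → ℝ) (hf : ∑ g, f g = 0) :
    nr (fun x => ∑ i, f (gens p i * x)) ≤ (1 - 1/10^12) * 9 * nr f := by
  by_cases h0 : nr f = 0
  · have := nr_sum Finset.univ (fun i x => f (gens p i * x))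
    simp only [nr_shift, h0, Finset.sum_const_zero] at this
    rw [h0]; simpa using this
  have hcon : ∃ (i j : Fin 3) (hij : i ≠ j), 1/50000 * nr f < nr (fun x => f (EE hij 1 * x) - f x) := by
    by_contra hcon; push Not at hcon
    exact h0 (gap_core f hf hcon)
  obtain ⟨i, j, hij, hlt⟩ := hcon
  have hg0 : gens p (0,0) = 1 := by simp [gens]
  have hg1 : gens p (i,j) = EE hij 1 := by simp [gens, hij]
  have hne : ((i,j) : Fin 3 × Fin 3) ≠ (0,0) := by
    intro h; rw [Prod.mk.injEq] at h; exact hij (h.1.trans h.2.symm)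
  have pair : nr (fun x => f (EE hij 1 * x) + f x) ≤ (2 - 1/10^11) * nr f := by
    apply nr_le_of_sq _ _ (by have := nr_nonneg f; apply mul_nonneg _ this; norm_num)
    have id : ∑ x, (f (EE hij 1 * x) + f x)^2 = 2 * nr (fun x => f (EE hij 1 * x))^2 + 2 * nr f^2 - nr (fun x => f (EE hij 1 * x) - f x)^2 := by
      rw [nr_sq, nr_sq, nr_sq, Finset.mul_sum, Finset.mul_sum, ← Finset.sum_add_distrib, ← Finset.sum_sub_distrib]
      apply Finset.sum_congr rfl; intro x _; ring
    rw [id, nr_shift]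
    have := nr_nonneg f
    have := pow_le_pow_left₀ (by positivity) hlt.le 2
    have := sq_nonneg (nr f)
    nlinarith
  have e : (fun x => ∑ i, f (gens p i * x)) = fun x => (f (EE hij 1 * x) + f x) + ∑ k ∈ (Finset.univ.erase (0,0)).erase (i,j), f (gens p k * x) := by
    ext x
    rw [← Finset.add_sum_erase Finset.univ _ (Finset.mem_univ (0,0)), ← Finset.add_sum_erase (Finset.univ.erase (0,0)) _ (Finset.mem_erase.2 ⟨hne, Finset.mem_univ _⟩), hg0, hg1, one_mul]
    ring
  rw [e]
  refine (nr_add _ _).trans ?_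
  have s := nr_sum ((Finset.univ.erase (0,0)).erase (i,j)) (fun i x => f (gens p i * x))
  simp only [nr_shift, Finset.sum_const] at s
  rw [Finset.card_erase_of_mem (Finset.mem_erase.2 ⟨hne, Finset.mem_univ _⟩), Finset.card_erase_of_mem (Finset.mem_univ _)] at s
  simp at s
  have := nr_nonneg f
  nlinarith

def Expd (G : Type) [Group G] [Fintype G] (D : ℕ) (l : ℝ) : Prop :=
  ∃ A : Fin D → G, ∀ f : G → ℝ, ∑ g, f g = 0 → nr (fun x => ∑ i, f (A i * x)) ≤ l * D * nr f

lemma Expd.mul {G : Type} [Group G] [Fintype G] {D D' : ℕ} {l l' : ℝ} (hl' : 0 ≤ l') (h : Expd G D l) (h' : Expd G D' l') :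
    Expd G (D * D') (l * l') := by
  obtain ⟨A, hA⟩ := h
  obtain ⟨A', hA'⟩ := h'
  obtain ⟨e⟩ : Nonempty (Fin (D * D') ≃ Fin D × Fin D') := ⟨finProdFinEquiv.symm⟩
  refine ⟨fun i => A (e i).1 * A' (e i).2, fun f hf => ?_⟩
  have e1 : (fun x => ∑ i, f (A (e i).1 * A' (e i).2 * x)) 
     = fun x => ∑ j, (∑ i, f (A i * (A' j * x))) := by
    ext x
    rw [Equiv.sum_comp e (fun i : Fin D × Fin D' => f (A i.1 * A' i.2 * x)), Fintype.sum_prod_type, Finset.sum_comm]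
    simp only [mul_assoc]
  rw [e1]
  have h2 := hA' (fun y => ∑ i, f (A i * y)) (by
    rw [Finset.sum_comm]
    apply Finset.sum_eq_zero; intro i _
    rw [← hf]; exact Equiv.sum_comp (Equiv.mulLeft (A i)) f)
  refine h2.trans ?_
  have := mul_le_mul_of_nonneg_left (hA f hf) (show 0 ≤ l' * D' by positivity)
  refine this.trans (le_of_eq ?_)
  push_cast; ring

lemma Expd.triv (G : Type) [Group G] [Fintype G] (k : ℕ) : Expd G k 1 := by
  refine ⟨fun _ => 1, fun f _ => ?_⟩
  have := nr_sum Finset.univ (fun (_ : Fin k) x => f (1 * x))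
  refine this.trans ?_
  simp

lemma Expd.pow {G : Type} [Group G] [Fintype G] {D : ℕ} {l : ℝ} (hl : 0 ≤ l) (h : Expd G D l) (t : ℕ) : Expd G (D ^ t) (l ^ t) := by
  induction t with
  | zero => simpa using Expd.triv G 1
  | succ t ih => rw [pow_succ, pow_succ]; exact Expd.mul hl ih h

lemma Expd_SL3 (p : ℕ) [Fact p.Prime] [Fintype (SL3 p)] : Expd (SL3 p) 9 (1 - 1/10^12) := by
  obtain ⟨e⟩ : Nonempty (Fin 9 ≃ Fin 3 × Fin 3) := ⟨(finProdFinEquiv (m := 3) (n := 3)).symm⟩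
  refine ⟨fun i => gens p (e i), fun f hf => ?_⟩
  have := gap_gens f hf
  have e1 : (fun x => ∑ i : Fin 9, f (gens p (e i) * x)) = fun x => ∑ i, f (gens p i * x) := by
    ext x
    exact Equiv.sum_comp e (fun i => f (gens p i * x))
  rw [e1]; exact_mod_cast this

theorem expanders (l : ℝ) (hl : 0 < l) : ∃ D : ℕ, 0 < D ∧ ∀ k N : ℕ, ∃ (G : Type) (_ : Group G) (_ : Fintype G),
    N ≤ Fintype.card G ∧ Expd G (D * k) l := by
  obtain ⟨t, ht⟩ := exists_pow_lt_of_lt_one hl (show (1 - 1/10^12 : ℝ) < 1 by norm_num)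
  refine ⟨9 ^ t, by positivity, fun k N => ?_⟩
  obtain ⟨p, hp, hpp⟩ := Nat.exists_infinite_primes N
  haveI : Fact p.Prime := ⟨hpp⟩
  letI : Fintype (SL3 p) := Fintype.ofFinite _
  refine ⟨SL3 p, inferInstance, inferInstance, ?_, ?_⟩
  · refine hp.trans ?_
    have := Fintype.card_le_of_injective (fun x : ZMod p => (EE (show (0 : Fin 3) ≠ 1 by decide) x : SL3 p)) ?_
    · rwa [ZMod.card] at this
    · intro x y hxy
      have := congrArg (fun g : SL3 p => (g * 1) 0 1) hxy
      simp only [EE_mul_apply, one_SL_apply] at this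
      simpa using this
  · have h1 : Expd (SL3 p) (9 ^ t * k) ((1 - 1/10^12)^t * 1) :=
      Expd.mul zero_le_one (Expd.pow (by norm_num) (Expd_SL3 p) t) (Expd.triv _ k)
    obtain ⟨A, hA⟩ := h1
    refine ⟨A, fun f hf => (hA f hf).trans ?_⟩
    have := nr_nonneg f
    rw [mul_one]
    gcongr


open Classical in
def SmallX {V : Type} [Fintype V] {Δ : ℕ} (n : Fin Δ → V → V) (N0 μ : ℝ) : Prop :=
  ∀ f : V → ℝ, ((Finset.univ.filter (fun v => f v ≠ 0)).card : ℝ) ≤ N0 →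
    ∑ v, (∑ a, f (n a v)) ^ 2 ≤ μ ^ 2 * Δ ^ 2 * ∑ v, f v ^ 2

def CC {Δ : ℕ} (C : Submodule (ZMod 2) (Fin Δ → ZMod 2)) (w : Fin Δ → Fin Δ → ZMod 2) : Prop :=
  (∀ a, w a ∈ C) ∧ ∀ b, (fun a => w a b) ∈ C

open Classical in
def Agr {Δ : ℕ} (C : Submodule (ZMod 2) (Fin Δ → ZMod 2)) (κ : ℝ) : Prop :=
  ∀ w1 w2 : Fin Δ → Fin Δ → ZMod 2, (∀ a, w1 a ∈ C) → (∀ b, (fun a => w2 a b) ∈ C) →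
    ∃ w, CC C w ∧ κ * Δ * ((Finset.univ.filter (fun a => w a ≠ w1 a)).card
      + (Finset.univ.filter (fun b => (fun a => w a b) ≠ (fun a => w2 a b))).card : ℕ)
      ≤ (Finset.univ.filter (fun ab : Fin Δ × Fin Δ => w1 ab.1 ab.2 ≠ w2 ab.1 ab.2)).card

def Cons {V : Type} {Δ : ℕ} (nA nB : Fin Δ → V → V) (T : V → Fin Δ → Fin Δ → ZMod 2) : Prop :=
  (∀ v a b, T (nA a v) a b = T v a b) ∧ (∀ v a b, T (nB b v) a b = T v a b)

section
open Classical
variable {V : Type} [Fintype V] {Δ : ℕ} (nA nB : Fin Δ → V → V)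

theorem core_dist (hΔ : 0 < Δ) (C : Submodule (ZMod 2) (Fin Δ → ZMod 2)) (α μ N0 : ℝ) (hμ : 0 ≤ μ) (hα : μ < α)
    (hC : ∀ x ∈ C, x ≠ 0 → α * Δ ≤ (Finset.univ.filter (fun i => x i ≠ 0)).card)
    (hS : SmallX nA N0 μ) (T : V → Fin Δ → Fin Δ → ZMod 2) (hT : Cons nA nB T) (hCC : ∀ v, CC C (T v))
    (hN : ((Finset.univ.filter (fun v => T v ≠ 0)).card : ℝ) ≤ N0) : ∀ v, T v = 0 := by
  set f : V → ℝ := fun v => if T v ≠ 0 then 1 else 0 with hf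
  have h1 := hS f (by
    refine le_trans (le_of_eq ?_) hN
    congr 3; ext v; simp [hf])
  have f0 : ∀ v, 0 ≤ f v := by intro v; simp only [hf]; split_ifs <;> norm_num
  have h2 : ∀ v, α * Δ * f v ≤ ∑ a, f (nA a v) := by
    intro v
    by_cases hv : T v = 0
    · have : f v = 0 := by simp [hf, hv]
      rw [this, mul_zero]; exact Finset.sum_nonneg (fun _ _ => f0 _)
    · have e : f v = 1 := by simp [hf, hv]
      obtain ⟨a0, ha0⟩ := Function.ne_iff.1 hv
      obtain ⟨b, hb⟩ := Function.ne_iff.1 ha0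
      have := hC _ ((hCC v).2 b) (fun h => hb (congrFun h a0))
      rw [e, mul_one]
      refine this.trans ?_
      rw [Finset.card_filter]; push_cast
      apply Finset.sum_le_sum; intro a _
      split_ifs with h
      · have : T (nA a v) ≠ 0 := by
          intro h0; apply h; rw [← hT.1 v a b, h0]; rfl
        simp [hf, this]
      · exact f0 _
  have h3 : (α * Δ) ^ 2 * ∑ v, f v ^ 2 ≤ ∑ v, (∑ a, f (nA a v)) ^ 2 := by
    rw [Finset.mul_sum]
    apply Finset.sum_le_sum; intro v _
    rw [← mul_pow]
    apply pow_le_pow_left₀ _ (h2 v)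
    have := f0 v
    have : 0 ≤ α := by linarith
    positivity
  have hS0 : 0 ≤ ∑ v, f v ^ 2 := Finset.sum_nonneg (fun _ _ => sq_nonneg _)
  have hD : (0:ℝ) < Δ := by exact_mod_cast hΔ
  have h4 : ∑ v, f v ^ 2 = 0 := by
    by_contra hne
    have hp := lt_of_le_of_ne hS0 (Ne.symm hne)
    have := h3.trans h1
    have h5 := le_of_mul_le_mul_right this hp
    rw [mul_pow] at h5
    have h6 := le_of_mul_le_mul_right h5 (by positivity)
    nlinarith
  intro v
  by_contra hv
  have := (Finset.sum_eq_zero_iff_of_nonneg (fun v _ => sq_nonneg (f v))).1 h4 v (Finset.mem_univ _)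
  simp [hf, hv] at this

noncomputable def dA (T : V → Fin Δ → Fin Δ → ZMod 2) (v : V) : ℕ := ∑ a, if T v a ≠ T (nA a v) a then 1 else 0
noncomputable def dB (T : V → Fin Δ → Fin Δ → ZMod 2) (v : V) : ℕ :=
  ∑ b, if (fun a => T v a b) ≠ (fun a => T (nB b v) a b) then 1 else 0

/-- changing at one vertex: generic symmetric statement -/
lemma change_sym {ι X : Type} [Fintype ι] (n : ι → V → V) (hn : ∀ i v, n i (n i v) = v) (hne : ∀ i v, n i v ≠ v)
    (T : V → X) (v0 : V) (t : X) (R : ι → X → X → Prop) (hR : ∀ i x y, R i x y → R i y x) :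
    (∑ v, ∑ i, if R i (Function.update T v0 t v) (Function.update T v0 t (n i v)) then 1 else 0)
      + 2 * (∑ i, if R i (T v0) (T (n i v0)) then 1 else 0)
    = (∑ v, ∑ i, if R i (T v) (T (n i v)) then 1 else 0) + 2 * (∑ i, if R i t (T (n i v0)) then 1 else 0) := by
  rw [Finset.sum_comm, Finset.sum_comm (s := (Finset.univ : Finset V))]
  rw [Finset.mul_sum, Finset.mul_sum, ← Finset.sum_add_distrib, ← Finset.sum_add_distrib]
  apply Finset.sum_congr rfl; intro i _
  have hs : ∀ x y, R i x y ↔ R i y x := fun x y => ⟨hR i x y, hR i y x⟩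
  have split : ∀ F : V → ℕ, ∑ v, F v = F v0 + (F (n i v0) + ∑ v ∈ (Finset.univ.erase v0).erase (n i v0), F v) := by
    intro F
    rw [Finset.add_sum_erase _ F (Finset.mem_erase.2 ⟨hne i v0, Finset.mem_univ _⟩), Finset.add_sum_erase _ F (Finset.mem_univ _)]
  rw [split, split (fun v => if R i (T v) (T (n i v)) then 1 else 0)]
  have hrest : ∑ v ∈ (Finset.univ.erase v0).erase (n i v0), (if R i (Function.update T v0 t v) (Function.update T v0 t (n i v)) then 1 else 0)
     = ∑ v ∈ (Finset.univ.erase v0).erase (n i v0), (if R i (T v) (T (n i v)) then 1 else 0) := by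
    apply Finset.sum_congr rfl
    intro v hv
    simp only [Finset.mem_erase] at hv
    have : n i v ≠ v0 := by
      intro h; apply hv.1; rw [← h, hn]
    rw [Function.update_of_ne hv.2.1, Function.update_of_ne this]
  rw [hrest]
  simp only [Function.update_self, Function.update_of_ne (hne i v0), hn]
  rw [hs (T (n i v0)) t, hs (T (n i v0)) (T v0)]
  ring

theorem core_test (hΔ : 0 < Δ) (C : Submodule (ZMod 2) (Fin Δ → ZMod 2)) (κ μ N0 : ℝ) (hμ : 0 ≤ μ) (hκ : 2 * μ < κ)
    (hC : Agr C κ) (hSA : SmallX nA N0 μ) (hSB : SmallX nB N0 μ)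
    (nA2 : ∀ a v, nA a (nA a v) = v) (nB2 : ∀ a v, nB a (nB a v) = v)
    (nAne : ∀ a v, nA a v ≠ v) (nBne : ∀ a v, nB a v ≠ v)
    (comm : ∀ a b v, nA a (nB b v) = nB b (nA a v))
    (y : V → Fin Δ → Fin Δ → ZMod 2) (hy : Cons nA nB y) :
    (∃ T, Cons nA nB T ∧ (∀ v, CC C (T v)) ∧ (Finset.univ.filter (fun v => y v ≠ T v)).card ≤
       (4 * Δ + 1) * (Finset.univ.filter (fun v => ¬ CC C (y v))).card)
    ∨ N0 ≤ 4 * Δ * (Finset.univ.filter (fun v => ¬ CC C (y v))).card := by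
  set bad := Finset.univ.filter (fun v => ¬ CC C (y v)) with hbad
  have zeroCC : CC C 0 := ⟨fun a => C.zero_mem, fun b => C.zero_mem⟩
  set T0 : V → Fin Δ → Fin Δ → ZMod 2 := fun v => if CC C (y v) then y v else 0 with hT0
  have hT0C : ∀ v, CC C (T0 v) := by
    intro v; simp only [hT0]; split_ifs with h
    · exact h
    · exact zeroCC
  set Dis : (V → Fin Δ → Fin Δ → ZMod 2) → ℕ := fun T => ∑ v, dA nA T v + ∑ v, dB nB T v with hDis
  set chg : (V → Fin Δ → Fin Δ → ZMod 2) → ℕ := fun T => (Finset.univ.filter (fun v => T v ≠ T0 v)).card with hchg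
  obtain ⟨T, hTm, hTmin⟩ := Finset.exists_min_image (Finset.univ.filter (fun T : V → Fin Δ → Fin Δ → ZMod 2 => ∀ v, CC C (T v)))
    (fun T => Dis T + chg T) ⟨T0, by simpa using hT0C⟩
  have hTC : ∀ v, CC C (T v) := by simpa using hTm
  have hmin : ∀ T', (∀ v, CC C (T' v)) → Dis T + chg T ≤ Dis T' + chg T' := fun T' h' => hTmin T' (by simpa using h')
  have chg0 : chg T0 = 0 := by simp [hchg]
  -- Dis T0 bound
  have cardpull : ∀ (n : Fin Δ → V → V) (hn : ∀ a v, n a (n a v) = v),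
      ∑ v, ∑ a, (if v ∈ bad ∨ n a v ∈ bad then 1 else 0) ≤ 2 * Δ * bad.card := by
    intro n hn
    have : ∀ v a, (if v ∈ bad ∨ n a v ∈ bad then 1 else 0) ≤ (if v ∈ bad then 1 else 0) + (if n a v ∈ bad then 1 else 0) := by
      intro v a; by_cases h1 : v ∈ bad <;> by_cases h2 : n a v ∈ bad <;> simp [h1, h2]
    refine (Finset.sum_le_sum (fun v _ => Finset.sum_le_sum (fun a _ => this v a))).trans ?_
    rw [Finset.sum_comm]
    have e : ∀ a, ∑ v, ((if v ∈ bad then 1 else 0) + (if n a v ∈ bad then 1 else 0)) = 2 * bad.card := by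
      intro a
      rw [Finset.sum_add_distrib]
      have := Equiv.sum_comp (⟨n a, n a, hn a, hn a⟩ : V ≃ V) (fun v => if v ∈ bad then 1 else 0)
      simp only [Equiv.coe_fn_mk] at this
      rw [this]
      simp; ring
    rw [Finset.sum_congr rfl (fun a _ => e a)]
    simp; apply le_of_eq; ring
  have hDis0 : Dis T0 ≤ 4 * Δ * bad.card := by
    have h1 : ∑ v, dA nA T0 v ≤ 2 * Δ * bad.card := by
      refine le_trans ?_ (cardpull nA nA2)
      unfold dA
      apply Finset.sum_le_sum; intro v _; apply Finset.sum_le_sum; intro a _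
      split_ifs with h1 h2 <;> try norm_num
      simp only [hbad, Finset.mem_filter, Finset.mem_univ, true_and, not_or, not_not] at h2
      apply h1; simp only [hT0, if_pos h2.1, if_pos h2.2]
      ext b; rw [hy.1]
    have h2 : ∑ v, dB nB T0 v ≤ 2 * Δ * bad.card := by
      refine le_trans ?_ (cardpull nB nB2)
      unfold dB
      apply Finset.sum_le_sum; intro v _; apply Finset.sum_le_sum; intro b _
      split_ifs with h1 h2 <;> try norm_num
      simp only [hbad, Finset.mem_filter, Finset.mem_univ, true_and, not_or, not_not] at h2
      apply h1; simp only [hT0, if_pos h2.1, if_pos h2.2]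
      ext a; rw [hy.2]
    have : Dis T0 = ∑ v, dA nA T0 v + ∑ v, dB nB T0 v := rfl
    nlinarith
  have hΦ : Dis T + chg T ≤ 4 * Δ * bad.card := by
    have := hmin T0 hT0C
    rw [chg0] at this
    omega
  by_cases hD0 : Dis T = 0
  · left
    have hA0 : ∀ v, dA nA T v = 0 := by
      have : ∑ v, dA nA T v = 0 := by simp only [hDis] at hD0; omega
      intro v; exact (Finset.sum_eq_zero_iff.1 this) v (Finset.mem_univ _)
    have hB0 : ∀ v, dB nB T v = 0 := by
      have : ∑ v, dB nB T v = 0 := by simp only [hDis] at hD0; omega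
      intro v; exact (Finset.sum_eq_zero_iff.1 this) v (Finset.mem_univ _)
    refine ⟨T, ⟨?_, ?_⟩, hTC, ?_⟩
    · intro v a b
      have := (Finset.sum_eq_zero_iff.1 (hA0 v)) a (Finset.mem_univ _)
      by_contra hne
      rw [if_pos (fun h => hne (congrFun h b).symm)] at this
      exact one_ne_zero this
    · intro v a b
      have := (Finset.sum_eq_zero_iff.1 (hB0 v)) b (Finset.mem_univ _)
      by_contra hne
      rw [if_pos (fun h => hne (congrFun h a).symm)] at this
      exact one_ne_zero this
    · have hsub : Finset.univ.filter (fun v => y v ≠ T v) ⊆ bad ∪ Finset.univ.filter (fun v => T v ≠ T0 v) := by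
        intro v hv
        simp only [Finset.mem_union, hbad, Finset.mem_filter, Finset.mem_univ, true_and] at hv ⊢
        by_contra hcon
        push Not at hcon
        apply hv; rw [hcon.2]; simp only [hT0, if_pos hcon.1]
      have := (Finset.card_le_card hsub).trans (Finset.card_union_le _ _)
      have e : (Finset.univ.filter (fun v => T v ≠ T0 v)).card = chg T := rfl
      nlinarith
  · right
    set d : V → ℕ := fun v => dA nA T v + dB nB T v with hd
    have hDd : Dis T = ∑ v, d v := by simp only [hDis, hd, Finset.sum_add_distrib]
    -- local minimality
    have hloc : ∀ v t, CC C t → d v ≤ (Finset.univ.filter (fun a => t a ≠ T (nA a v) a)).card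
        + (Finset.univ.filter (fun b => (fun a => t a b) ≠ (fun a => T (nB b v) a b))).card := by
      intro v t ht
      have hT' : ∀ u, CC C (Function.update T v t u) := by
        intro u
        by_cases hu : u = v
        · subst hu; simpa using ht
        · rw [Function.update_of_ne hu]; exact hTC u
      have hm := hmin _ hT'
      have cA := change_sym nA nA2 nAne T v t (fun a x y => x a ≠ y a) (fun _ _ _ h => h.symm)
      have cB := change_sym nB nB2 nBne T v t (fun b x y => (fun a => x a b) ≠ (fun a => y a b)) (fun _ _ _ h => h.symm)
      have hc : chg (Function.update T v t) ≤ chg T + 1 := by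
        have : Finset.univ.filter (fun u => Function.update T v t u ≠ T0 u) ⊆ insert v (Finset.univ.filter (fun u => T u ≠ T0 u)) := by
          intro u hu
          simp only [Finset.mem_insert, Finset.mem_filter, Finset.mem_univ, true_and] at hu ⊢
          by_cases h : u = v
          · left; exact h
          · right; rwa [Function.update_of_ne h] at hu
        exact (Finset.card_le_card this).trans (Finset.card_insert_le _ _)
      have cA' : ∑ u, dA nA (Function.update T v t) u + 2 * dA nA T v = ∑ u, dA nA T u + 2 * (Finset.univ.filter (fun a => t a ≠ T (nA a v) a)).card := by
        rw [Finset.card_filter]; unfold dA; convert cA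
      have cB' : ∑ u, dB nB (Function.update T v t) u + 2 * dB nB T v = ∑ u, dB nB T u + 2 * (Finset.univ.filter (fun b => (fun a => t a b) ≠ (fun a => T (nB b v) a b))).card := by
        rw [Finset.card_filter]; unfold dB; convert cB
      simp only [hDis, hd] at hm ⊢
      omega
    have hkey : ∀ v, κ * Δ * (d v : ℝ) ≤ ∑ a, (d (nA a v) : ℝ) + ∑ b, (d (nB b v) : ℝ) := by
      intro v
      obtain ⟨w, hw, hle⟩ := hC (fun a => T (nA a v) a) (fun a b => T (nB b v) a b) (fun a => (hTC _).1 a) (fun b => (hTC _).2 b)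
      have h1 := hloc v w hw
      have hκ0 : 0 ≤ κ := by linarith
      have h2 : κ * Δ * (d v : ℝ) ≤ _ := (mul_le_mul_of_nonneg_left (Nat.cast_le.2 h1) (by positivity)).trans hle
      refine h2.trans ?_
      rw [Finset.card_filter, ← Nat.cast_sum, ← Nat.cast_sum, ← Nat.cast_add]
      apply Nat.cast_le.2
      have : ∀ ab : Fin Δ × Fin Δ, (if T (nA ab.1 v) ab.1 ab.2 ≠ T (nB ab.2 v) ab.1 ab.2 then 1 else 0)
         ≤ (if (fun a => T (nA ab.1 v) a ab.2) ≠ (fun a => T (nB ab.2 (nA ab.1 v)) a ab.2) then 1 else 0)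
         + (if T (nB ab.2 v) ab.1 ≠ T (nA ab.1 (nB ab.2 v)) ab.1 then 1 else 0) := by
        rintro ⟨a, b⟩
        dsimp only
        by_cases h1 : (fun a' => T (nA a v) a' b) = (fun a' => T (nB b (nA a v)) a' b)
        · by_cases h2 : T (nB b v) a = T (nA a (nB b v)) a
          · have e1 := congrFun h1 a
            have e2 := congrFun h2 b
            rw [comm] at e2
            simp [e1, e2]
          · rw [if_pos h2]; split_ifs <;> omega
        · rw [if_pos h1]; split_ifs <;> omega
      refine (Finset.sum_le_sum (fun ab _ => this ab)).trans ?_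
      rw [Finset.sum_add_distrib, Fintype.sum_prod_type, Fintype.sum_prod_type_right]
      apply add_le_add
      · apply Finset.sum_le_sum; intro a _
        simp only [hd, dB]; omega
      · apply Finset.sum_le_sum; intro b _
        simp only [hd, dA]; omega
    by_contra hN
    push Not at hN
    have hsupp : ((Finset.univ.filter (fun v => (d v : ℝ) ≠ 0)).card : ℝ) ≤ N0 := by
      refine le_trans ?_ hN.le
      have : (Finset.univ.filter (fun v => (d v : ℝ) ≠ 0)).card ≤ Dis T := by
        rw [hDd, Finset.card_filter]
        apply Finset.sum_le_sum; intro v _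
        split_ifs with h
        · have : d v ≠ 0 := by exact_mod_cast h
          omega
        · omega
      have h3 : (Finset.univ.filter (fun v => (d v : ℝ) ≠ 0)).card ≤ 4 * Δ * bad.card := by omega
      exact_mod_cast h3
    have eA := hSA (fun v => (d v : ℝ)) hsupp
    have eB := hSB (fun v => (d v : ℝ)) hsupp
    have h3 : (κ * Δ) ^ 2 * ∑ v, (d v : ℝ) ^ 2 ≤ 2 * ∑ v, (∑ a, (d (nA a v) : ℝ)) ^ 2 + 2 * ∑ v, (∑ a, (d (nB a v) : ℝ)) ^ 2 := by
      rw [Finset.mul_sum, Finset.mul_sum, Finset.mul_sum, ← Finset.sum_add_distrib]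
      apply Finset.sum_le_sum; intro v _
      rw [← mul_pow]
      have hκ0 : 0 ≤ κ := by linarith
      have := pow_le_pow_left₀ (by positivity) (hkey v) 2
      nlinarith [sq_nonneg (∑ a, (d (nA a v) : ℝ) - ∑ b, (d (nB b v) : ℝ))]
    have hS0 : 0 < ∑ v, (d v : ℝ) ^ 2 := by
      apply lt_of_le_of_ne (Finset.sum_nonneg (fun _ _ => sq_nonneg _))
      intro h
      apply hD0
      rw [hDd]
      apply Finset.sum_eq_zero; intro v hv
      have := (Finset.sum_eq_zero_iff_of_nonneg (fun v _ => sq_nonneg ((d v : ℝ)))).1 h.symm v hv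
      exact_mod_cast pow_eq_zero_iff (two_ne_zero) |>.1 this
    have hD : (0:ℝ) < Δ := by exact_mod_cast hΔ
    have h5 : (κ * Δ)^2 * ∑ v, (d v : ℝ) ^ 2 ≤ (4 * μ ^ 2 * Δ ^ 2) * ∑ v, (d v : ℝ) ^ 2 := by nlinarith
    have h6 := le_of_mul_le_mul_right h5 hS0
    rw [mul_pow] at h6
    have h7 := le_of_mul_le_mul_right h6 (by positivity)
    nlinarith
end


section
variable {G : Type} [Fintype G] {Δ : ℕ}

def Ex (σ : Fin Δ → Equiv.Perm G) (l : ℝ) : Prop :=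
  ∀ f : G → ℝ, ∑ g, f g = 0 → nr (fun x => ∑ i, f (σ i x)) ≤ l * Δ * nr f

lemma nr_cs (f g : G → ℝ) : ∑ x, f x * g x ≤ nr f * nr g := by
  exact Real.sum_mul_le_sqrt_mul_sqrt _ _ _

lemma Ex.adj {σ : Fin Δ → Equiv.Perm G} {l : ℝ} (hl : 0 ≤ l) (h : Ex σ l) : Ex (fun i => (σ i).symm) l := by
  intro f hf
  set g : G → ℝ := fun x => ∑ i, f ((σ i).symm x) with hg
  have hg0 : ∑ x, g x = 0 := by
    simp only [hg]
    rw [Finset.sum_comm]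
    apply Finset.sum_eq_zero; intro i _
    rw [Equiv.sum_comp (σ i).symm f, hf]
  have h1 := h g hg0
  have h2 : nr g ^ 2 = ∑ x, f x * ∑ i, g (σ i x) := by
    rw [nr_sq]
    simp only [Finset.mul_sum]
    rw [Finset.sum_comm]
    have : ∀ i, ∑ x, f x * g (σ i x) = ∑ x, f ((σ i).symm x) * g x := by
      intro i
      rw [← Equiv.sum_comp (σ i) (fun x => f ((σ i).symm x) * g x)]
      simp
    rw [Finset.sum_congr rfl (fun i _ => this i), Finset.sum_comm]
    apply Finset.sum_congr rfl; intro x _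
    rw [← Finset.sum_mul, sq]
  have h3 := nr_cs f (fun x => ∑ i, g (σ i x))
  rw [← h2] at h3
  have hf0 := nr_nonneg f
  have hgn := nr_nonneg g
  rcases hgn.eq_or_lt with h0 | h0
  · rw [← h0]; positivity
  · have h4 : nr g * nr g ≤ (l * Δ * nr f) * nr g := by
      have := mul_le_mul_of_nonneg_left h1 hf0
      nlinarith
    exact le_of_mul_le_mul_right h4 h0

lemma Ex.conj {σ σ' : Fin Δ → Equiv.Perm G} {l : ℝ} (h : Ex σ l) (τ : Equiv.Perm G) (hσ : ∀ i x, σ' i x = τ.symm (σ i (τ x))) :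
    Ex σ' l := by
  intro f hf
  have h1 := h (fun x => f (τ.symm x)) (by rw [Equiv.sum_comp τ.symm f, hf])
  have e1 : nr (fun x => f (τ.symm x)) = nr f := by
    unfold nr; rw [Equiv.sum_comp τ.symm (fun x => f x ^ 2)]
  have e2 : nr (fun x => ∑ i, f (σ' i x)) = nr (fun x => ∑ i, f (τ.symm (σ i x))) := by
    unfold nr; simp only [hσ]
    rw [Equiv.sum_comp τ (fun x => (∑ i, f (τ.symm (σ i x))) ^ 2)]
  rw [e2, ← e1]; exact h1

open Classical in
lemma Ex.small {σ : Fin Δ → Equiv.Perm G} {l : ℝ} (h : Ex σ l) (f : G → ℝ) (θ : ℝ) (hl : 0 ≤ l) 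
    (hs : ((Finset.univ.filter (fun v => f v ≠ 0)).card : ℝ) ≤ θ * Fintype.card G) :
    ∑ x, (∑ i, f (σ i x)) ^ 2 ≤ (θ + l ^ 2) * Δ ^ 2 * ∑ x, f x ^ 2 := by
  rcases isEmpty_or_nonempty G with hE | hE
  · simp
  have hc : (0:ℝ) < Fintype.card G := by exact_mod_cast Fintype.card_pos
  set m : ℝ := (∑ x, f x) / Fintype.card G with hm
  have hm' : ∑ x, f x = m * Fintype.card G := by rw [hm]; field_simp
  have h0 : ∑ x, (f x - m) = 0 := by
    rw [Finset.sum_sub_distrib, hm']; simp; ring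
  have h1 := h (fun x => f x - m) h0
  have h1' := pow_le_pow_left₀ (nr_nonneg _) h1 2
  rw [mul_pow, nr_sq, nr_sq] at h1'
  have h2 : ∑ x, (f x - m) ^ 2 = ∑ x, f x ^ 2 - m ^ 2 * Fintype.card G := by
    have : ∀ x, (f x - m)^2 = f x ^ 2 - 2 * m * (f x - m) - m ^ 2 := by intro x; ring
    simp only [this]
    rw [Finset.sum_sub_distrib, Finset.sum_sub_distrib, ← Finset.mul_sum, h0]
    simp; ring
  have h00 : ∑ x, ∑ i, (f (σ i x) - m) = 0 := by
    rw [Finset.sum_comm]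
    apply Finset.sum_eq_zero; intro i _
    rw [Equiv.sum_comp (σ i) (fun x => f x - m), h0]
  have h3 : ∑ x, (∑ i, f (σ i x)) ^ 2 = ∑ x, (∑ i, (f (σ i x) - m)) ^ 2 + Δ ^ 2 * m ^ 2 * Fintype.card G := by
    have : ∀ x, (∑ i, f (σ i x)) ^ 2 = (∑ i, (f (σ i x) - m)) ^ 2 + 2 * Δ * m * (∑ i, (f (σ i x) - m)) + Δ ^ 2 * m ^ 2 := by
      intro x
      rw [Finset.sum_sub_distrib]; simp; ring
    simp only [this]
    rw [Finset.sum_add_distrib, Finset.sum_add_distrib, ← Finset.mul_sum, h00]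
    simp; ring
  have h4 : m ^ 2 * Fintype.card G ≤ θ * ∑ x, f x ^ 2 := by
    have cs : (∑ x, f x) ^ 2 ≤ (Finset.univ.filter (fun v => f v ≠ 0)).card * ∑ x, f x ^ 2 := by
      have e1 : ∑ x, f x = ∑ x ∈ Finset.univ.filter (fun v => f v ≠ 0), f x := by
        rw [Finset.sum_filter_ne_zero]
      rw [e1]
      refine sq_sum_le_card_mul_sum_sq.trans ?_
      apply mul_le_mul_of_nonneg_left _ (Nat.cast_nonneg _)
      exact Finset.sum_le_sum_of_subset_of_nonneg (Finset.subset_univ _) (fun _ _ _ => sq_nonneg _)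
    have hS0 : 0 ≤ ∑ x, f x ^ 2 := Finset.sum_nonneg (fun _ _ => sq_nonneg _)
    have : m ^ 2 * Fintype.card G * Fintype.card G ≤ θ * (∑ x, f x ^ 2) * Fintype.card G := by
      calc m ^ 2 * Fintype.card G * Fintype.card G = (∑ x, f x) ^ 2 := by rw [hm']; ring
        _ ≤ _ := cs
        _ ≤ θ * Fintype.card G * ∑ x, f x ^ 2 := by gcongr
        _ = _ := by ring
    exact le_of_mul_le_mul_right this hc
  rw [h3]
  have hm2 : 0 ≤ m ^ 2 * Fintype.card G := by positivity
  have hD : (0:ℝ) ≤ Δ ^ 2 := by positivity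
  have h5 : ∑ x, (∑ i, (f (σ i x) - m)) ^ 2 ≤ l ^ 2 * Δ ^ 2 * ∑ x, f x ^ 2 := by
    refine h1'.trans ?_
    rw [h2, mul_pow]
    apply mul_le_mul_of_nonneg_left _ (by positivity)
    linarith
  have h6 := mul_le_mul_of_nonneg_left h4 hD
  nlinarith
end

section
variable {G : Type} [Fintype G] [Group G] {Δ : ℕ}

def nA (A : Fin Δ → G) (a : Fin Δ) (v : Bool × Bool × G) : Bool × Bool × G :=
  (!v.1, v.2.1, if v.1 then (A a)⁻¹ * v.2.2 else A a * v.2.2)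
def nB (A : Fin Δ → G) (b : Fin Δ) (v : Bool × Bool × G) : Bool × Bool × G :=
  (v.1, !v.2.1, if v.2.1 then v.2.2 * (A b)⁻¹ else v.2.2 * A b)

lemma nA2 (A : Fin Δ → G) (a v) : nA A a (nA A a v) = v := by
  obtain ⟨s, t, h⟩ := v; cases s <;> simp [nA]
lemma nB2 (A : Fin Δ → G) (a v) : nB A a (nB A a v) = v := by
  obtain ⟨s, t, h⟩ := v; cases t <;> simp [nB]
lemma nAne (A : Fin Δ → G) (a v) : nA A a v ≠ v := by
  obtain ⟨s, t, h⟩ := v; cases s <;> simp [nA]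
lemma nBne (A : Fin Δ → G) (a v) : nB A a v ≠ v := by
  obtain ⟨s, t, h⟩ := v; cases t <;> simp [nB]
lemma nAB (A : Fin Δ → G) (a b v) : nA A a (nB A b v) = nB A b (nA A a v) := by
  obtain ⟨s, t, h⟩ := v; cases t <;> cases s <;> simp [nB, nA, mul_assoc]

open Classical in
lemma small_part (θ : ℝ) (f : Bool × Bool × G → ℝ)
    (hs : ((Finset.univ.filter (fun v => f v ≠ 0)).card : ℝ) ≤ θ) (s t : Bool) :
   ((Finset.univ.filter (fun v => f (s, t, v) ≠ 0)).card : ℝ) ≤ θ := by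
  refine le_trans ?_ hs
  apply Nat.cast_le.2
  apply Finset.card_le_card_of_injOn (fun v => (s, t, v))
  · intro v; simp
  · intro v _ w _ h; simpa using h

lemma small_nA (A : Fin Δ → G) (l θ : ℝ) (hl : 0 ≤ l) (hθ : 0 ≤ θ) (h : Ex (fun i => Equiv.mulLeft (A i)) l) :
    SmallX (nA A) (θ * Fintype.card G) (Real.sqrt (θ + l ^ 2)) := by
  intro f hs
  have h1 := h
  have h2 : Ex (fun i => Equiv.mulLeft (A i)⁻¹) l := by
    have := h.adj hl
    exact this
  rw [Real.sq_sqrt (by positivity)]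
  have p1 := fun s t => h1.small (fun v => f (s, t, v)) θ hl (small_part _ f hs s t)
  have p2 := fun s t => h2.small (fun v => f (s, t, v)) θ hl (small_part _ f hs s t)
  simp only [Fintype.sum_prod_type, Fintype.sum_bool, nA]
  simp only [Bool.not_true, Bool.not_false, if_true, Bool.false_eq_true, if_false]
  have q1 := p2 false true
  have q2 := p2 false false
  have q3 := p1 true true
  have q4 := p1 true false
  simp only [Equiv.coe_mulLeft] at q1 q2 q3 q4
  linarith

lemma small_nB (A : Fin Δ → G) (l θ : ℝ) (hl : 0 ≤ l) (hθ : 0 ≤ θ) (h : Ex (fun i => Equiv.mulLeft (A i)) l) :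
    SmallX (nB A) (θ * Fintype.card G) (Real.sqrt (θ + l ^ 2)) := by
  intro f hs
  have h2 : Ex (fun i => Equiv.mulRight (A i)⁻¹) l := by
    apply h.conj (Equiv.inv G)
    intro i x; simp
  have h1 : Ex (fun i => Equiv.mulRight (A i)) l := by
    have := h2.adj hl
    simpa using this
  rw [Real.sq_sqrt (by positivity)]
  have p1 := fun s t => h1.small (fun v => f (s, t, v)) θ hl (small_part _ f hs s t)
  have p2 := fun s t => h2.small (fun v => f (s, t, v)) θ hl (small_part _ f hs s t)
  simp only [Fintype.sum_prod_type, Fintype.sum_bool, nB]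
  simp only [Bool.not_true, Bool.not_false, if_true, Bool.false_eq_true, if_false]
  have q1 := p2 false false
  have q2 := p2 true false
  have q3 := p1 true true
  have q4 := p1 false true
  simp only [Equiv.coe_mulRight] at q1 q2 q3 q4
  linarith
end


section
open Classical
variable {n m : ℕ} (f : Fin n → Fin 6 → Fin m)

def Nb (X : Finset (Fin n)) : Finset (Fin m) := X.biUnion (fun i => Finset.univ.image (f i))

noncomputable def chk (r : Fin m) : (Fin n → ZMod 2) →ₗ[ZMod 2] ZMod 2 :=
  ∑ i, ∑ j, if f i j = r then LinearMap.proj i else 0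

lemma chk_apply (r : Fin m) (x : Fin n → ZMod 2) : chk f r x = ∑ i, ∑ j, if f i j = r then x i else 0 := by
  simp only [chk, LinearMap.sum_apply]
  apply Finset.sum_congr rfl; intro i _
  apply Finset.sum_congr rfl; intro j _
  split_ifs <;> simp

noncomputable def code : Submodule (ZMod 2) (Fin n → ZMod 2) := ⨅ r, LinearMap.ker (chk f r)

lemma mem_code (x : Fin n → ZMod 2) : x ∈ code f ↔ ∀ r, chk f r x = 0 := by
  simp [code]

def Lossless (α : ℝ) : Prop := ∀ X : Finset (Fin n), X.Nonempty → (X.card : ℝ) ≤ α * n → 4 * X.card < (Nb f X).card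

variable {f} {α : ℝ}

lemma key_uniq (hX : Lossless f α) (x : Fin n → ZMod 2) (L : Finset (Fin n)) (T : Finset (Fin m))
    (h1 : ∀ r, r ∉ T → chk f r x = 0) (h2 : ∀ v ∈ L, ∀ j, f v j ∈ T)
    (h3 : ∀ v, v ∉ L → (Finset.univ.filter (fun j => f v j ∈ T)).card ≤ 2)
    (hne : ∃ v, v ∉ L ∧ x v ≠ 0) :
    α * n < (Finset.univ.filter (fun v => v ∉ L ∧ x v ≠ 0)).card := by
  set X := Finset.univ.filter (fun v => v ∉ L ∧ x v ≠ 0) with hXd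
  by_contra hcon
  push Not at hcon
  have hXn : X.Nonempty := by obtain ⟨v, hv⟩ := hne; exact ⟨v, by simp [hXd, hv]⟩
  have hN := hX X hXn hcon
  -- incidence count
  set cnt : Fin m → ℕ := fun r => ((X ×ˢ (Finset.univ : Finset (Fin 6))).filter (fun p => f p.1 p.2 = r)).card with hcnt
  have htot : ∑ r ∈ Nb f X, cnt r = 6 * X.card := by
    have := Finset.card_eq_sum_card_fiberwise (s := X ×ˢ (Finset.univ : Finset (Fin 6))) (t := Nb f X) (f := fun p => f p.1 p.2) (by
      intro p hp
      simp only [Finset.coe_product, Set.mem_prod, Finset.mem_coe] at hp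
      simp only [Nb, Finset.coe_biUnion, Set.mem_iUnion]
      exact ⟨p.1, hp.1, by simp⟩)
    rw [Finset.card_product] at this
    simp at this
    simp only [hcnt]
    linarith
  have hpos : ∀ r ∈ Nb f X, 1 ≤ cnt r := by
    intro r hr
    simp only [Nb, Finset.mem_biUnion, Finset.mem_image, Finset.mem_univ, true_and] at hr
    obtain ⟨i, hi, j, hj⟩ := hr
    apply Finset.card_pos.2
    exact ⟨(i, j), by simp [hi, hj]⟩
  set U := (Nb f X).filter (fun r => cnt r = 1) with hU
  have hUc : 2 * X.card < U.card := by
    have : 2 * (Nb f X).card ≤ ∑ r ∈ Nb f X, cnt r + U.card := by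
      rw [hU, Finset.card_filter, ← Finset.sum_add_distrib, mul_comm, ← smul_eq_mul]
      apply Finset.card_nsmul_le_sum
      intro r hr
      have := hpos r hr
      split_ifs <;> omega
    omega
  have hUT : ∃ r ∈ U, r ∉ T := by
    by_contra hc
    push Not at hc
    have : U.card ≤ 2 * X.card := by
      have hsub : U ⊆ (X.biUnion (fun v => (Finset.univ.filter (fun j => f v j ∈ T)).image (f v))) := by
        intro r hr
        have hrT := hc r hr
        simp only [hU, Nb, Finset.mem_filter, Finset.mem_biUnion, Finset.mem_image, Finset.mem_univ, true_and] at hr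
        obtain ⟨⟨i, hi, j, hj⟩, _⟩ := hr
        simp only [Finset.mem_biUnion, Finset.mem_image, Finset.mem_filter, Finset.mem_univ, true_and]
        exact ⟨i, hi, j, by rwa [hj], hj⟩
      refine (Finset.card_le_card hsub).trans ?_
      rw [mul_comm]
      apply Finset.card_biUnion_le_card_mul
      intro v hv
      refine Finset.card_image_le.trans (h3 v ?_)
      simp only [hXd, Finset.mem_filter] at hv
      exact hv.2.1
    omega
  obtain ⟨r, hrU, hrT⟩ := hUT
  have hc1 : cnt r = 1 := by simp only [hU, Finset.mem_filter] at hrU; exact hrU.2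
  have h0 := h1 r hrT
  rw [chk_apply, ← Fintype.sum_prod_type'] at h0
  obtain ⟨p, hp⟩ := Finset.card_eq_one.1 hc1
  have hpm : p ∈ ((X ×ˢ (Finset.univ : Finset (Fin 6))).filter (fun p => f p.1 p.2 = r)) := by rw [hp]; simp
  simp only [Finset.mem_filter, Finset.mem_product, hXd, Finset.mem_univ, true_and, and_true] at hpm
  rw [Finset.sum_eq_single p] at h0
  · rw [if_pos hpm.2] at h0; exact hpm.1.2 h0
  · intro q _ hq
    split_ifs with h
    · by_contra hxq
      by_cases hqL : q.1 ∈ L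
      · exact hrT (h ▸ h2 q.1 hqL q.2)
      · have : q ∈ ((X ×ˢ (Finset.univ : Finset (Fin 6))).filter (fun p => f p.1 p.2 = r)) := by
          simp [hXd, hqL, hxq, h]
        rw [hp] at this
        exact hq (by simpa using this)
    · rfl
  · intro h; exact absurd (Finset.mem_univ _) h

lemma code_dist (hX : Lossless f α) (x : Fin n → ZMod 2) (hx : x ∈ code f) (h0 : x ≠ 0) :
    α * n < (Finset.univ.filter (fun v => x v ≠ 0)).card := by
  have := key_uniq hX x ∅ ∅ (fun r _ => (mem_code f x).1 hx r) (by simp) (by simp) (by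
    obtain ⟨v, hv⟩ := Function.ne_iff.1 h0
    exact ⟨v, by simp, hv⟩)
  simpa using this

lemma closure_L (hX : Lossless f α) (T0 : Finset (Fin m)) (hT0 : (T0.card : ℝ) ≤ α * n) :
    ∃ (L : Finset (Fin n)) (T : Finset (Fin m)), L.card ≤ T0.card ∧ T0 ⊆ T ∧ (∀ v ∈ L, ∀ j, f v j ∈ T) ∧
     (∀ v, v ∉ L → (Finset.univ.filter (fun j => f v j ∈ T)).card ≤ 2) := by
  set S := Finset.univ.filter (fun L : Finset (Fin n) => (L.card : ℝ) ≤ α * n ∧ (T0 ∪ Nb f L).card ≤ T0.card + 3 * L.card) with hS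
  have h0 : (∅ : Finset (Fin n)) ∈ S := by
    have : (0:ℝ) ≤ T0.card := Nat.cast_nonneg _
    have hN : Nb f ∅ = ∅ := by simp [Nb]
    rw [hS, Finset.mem_filter]
    refine ⟨Finset.mem_univ _, ?_, ?_⟩
    · rw [Finset.card_empty]; push_cast; linarith
    · rw [hN]; simp
  obtain ⟨L, hLS, hLmax⟩ := Finset.exists_max_image S Finset.card ⟨∅, h0⟩
  have hL : (L.card : ℝ) ≤ α * n ∧ (T0 ∪ Nb f L).card ≤ T0.card + 3 * L.card := by
    simpa only [hS, Finset.mem_filter, Finset.mem_univ, true_and] using hLS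
  have hlt : L.Nonempty → L.card < T0.card := by
    intro hn
    have := hX L hn hL.1
    have h2 := Finset.card_le_card (Finset.subset_union_right : Nb f L ⊆ T0 ∪ Nb f L)
    omega
  refine ⟨L, T0 ∪ Nb f L, ?_, Finset.subset_union_left, ?_, ?_⟩
  · rcases L.eq_empty_or_nonempty with h | h
    · rw [h]; simp
    · exact (hlt h).le
  · intro v hv j
    apply Finset.mem_union_right
    simp only [Nb, Finset.mem_biUnion, Finset.mem_image, Finset.mem_univ, true_and]
    exact ⟨v, hv, j, rfl⟩
  · intro v hv
    by_contra hc
    push Not at hc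
    set T := T0 ∪ Nb f L with hT
    have hcard : (insert v L).card = L.card + 1 := Finset.card_insert_of_notMem hv
    have hle : L.card + 1 ≤ T0.card := by
      rcases L.eq_empty_or_nonempty with h | h
      · subst h
        have : (Finset.univ.filter (fun j => f v j ∈ T)).Nonempty := Finset.card_pos.1 (by omega)
        obtain ⟨j, hj⟩ := this
        simp only [Finset.mem_filter, hT, Nb] at hj
        simp at hj
        have := Finset.card_pos.2 ⟨_, hj⟩
        simpa using this
      · exact hlt h
    have hmem : insert v L ∈ S := by
      simp only [hS, Finset.mem_filter, Finset.mem_univ, true_and]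
      constructor
      · rw [hcard]
        refine le_trans ?_ hT0
        exact_mod_cast hle
      · have hsub : T0 ∪ Nb f (insert v L) ⊆ T ∪ (Finset.univ.filter (fun j => ¬ f v j ∈ T)).image (f v) := by
          intro r hr
          by_cases hrT : r ∈ T
          · exact Finset.mem_union_left _ hrT
          apply Finset.mem_union_right
          have hr1 : r ∉ T0 := fun h => hrT (Finset.mem_union_left _ h)
          have hr2 : r ∉ Nb f L := fun h => hrT (Finset.mem_union_right _ h)
          simp only [Finset.mem_union, hr1, false_or, Nb, Finset.biUnion_insert] at hr
          have hr3 : r ∈ Finset.univ.image (f v) := by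
            rcases hr with h | h
            · exact h
            · exact absurd h hr2
          simp only [Finset.mem_image, Finset.mem_univ, true_and, Finset.mem_filter] at hr3 ⊢
          obtain ⟨j, hj⟩ := hr3
          exact ⟨j, by rwa [hj], hj⟩
        have c1 := (Finset.card_le_card hsub).trans (Finset.card_union_le _ _)
        have c2 : ((Finset.univ.filter (fun j => ¬ f v j ∈ T)).image (f v)).card ≤ (Finset.univ.filter (fun j => ¬ f v j ∈ T)).card := Finset.card_image_le
        have c3 := Finset.card_filter_add_card_filter_not (s := (Finset.univ : Finset (Fin 6))) (fun j => f v j ∈ T)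
        simp only [Finset.card_univ, Fintype.card_fin] at c3
        have := hL.2
        omega
    have := hLmax _ hmem
    omega

lemma code_agr (hX : Lossless f α) (hα : 0 < α) (hα1 : α ≤ 1) : Agr (code f) (α ^ 2 / 24) := by
  intro w1 w2 hw1 hw2
  rcases Nat.eq_zero_or_pos n with hn0 | hn
  · subst hn0
    exact ⟨0, ⟨fun a => (code f).zero_mem, fun a => (code f).zero_mem⟩, by simp⟩
  have hnR : (0:ℝ) < n := by exact_mod_cast hn
  set E := Finset.univ.filter (fun ab : Fin n × Fin n => w1 ab.1 ab.2 ≠ w2 ab.1 ab.2) with hE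
  have zerocase : α ^ 2 * n ^ 2 ≤ 6 * E.card → ∃ w, CC (code f) w ∧ (α ^ 2 / 24) * n * ((Finset.univ.filter (fun a => w a ≠ w1 a)).card
      + (Finset.univ.filter (fun b => (fun a => w a b) ≠ (fun a => w2 a b))).card : ℕ) ≤ E.card := by
    intro h
    refine ⟨0, ⟨fun a => (code f).zero_mem, fun a => (code f).zero_mem⟩, ?_⟩
    have c1 := Finset.card_le_univ (Finset.univ.filter (fun a => (0 : Fin n → Fin n → ZMod 2) a ≠ w1 a))
    have c2 := Finset.card_le_univ (Finset.univ.filter (fun b => (fun a => (0 : Fin n → Fin n → ZMod 2) a b) ≠ (fun a => w2 a b)))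
    rw [Fintype.card_fin] at c1 c2
    have c3 : (((Finset.univ.filter (fun a => (0 : Fin n → Fin n → ZMod 2) a ≠ w1 a)).card + (Finset.univ.filter (fun b => (fun a => (0 : Fin n → Fin n → ZMod 2) a b) ≠ (fun a => w2 a b))).card : ℕ) : ℝ) ≤ 2 * n := by
      have := add_le_add c1 c2
      have : _ ≤ 2 * n := this.trans (by omega)
      exact_mod_cast this
    refine (mul_le_mul_of_nonneg_left c3 (by positivity)).trans ?_
    nlinarith
  -- syndrome rows
  set S : Fin m → Fin n → ZMod 2 := fun r b => chk f r (fun a => w1 a b) with hS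
  have hSC : ∀ r, S r ∈ code f := by
    intro r
    have : S r = ∑ i, ∑ j, if f i j = r then w1 i else 0 := by
      ext b
      simp only [hS, chk_apply, Finset.sum_apply]
      apply Finset.sum_congr rfl; intro i _
      apply Finset.sum_congr rfl; intro j _
      split_ifs <;> rfl
    rw [this]
    apply Submodule.sum_mem; intro i _
    apply Submodule.sum_mem; intro j _
    split_ifs
    · exact hw1 i
    · exact Submodule.zero_mem _
  have hSd : ∀ r b, chk f r (fun a => w1 a b - w2 a b) = S r b := by
    intro r b
    have : (fun a => w1 a b - w2 a b) = (fun a => w1 a b) - (fun a => w2 a b) := rfl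
    rw [this, map_sub, (mem_code f _).1 (hw2 b) r, sub_zero]
  set R0 := Finset.univ.filter (fun r => S r ≠ 0) with hR0
  have hR0c : R0.card * (α * n) ≤ 6 * E.card := by
    set P := Finset.univ.filter (fun p : Fin m × Fin n => S p.1 p.2 ≠ 0) with hP
    have h1 : R0.card * (α * n) ≤ P.card := by
      have e : P.card = ∑ r, (Finset.univ.filter (fun b => S r b ≠ 0)).card := by
        rw [hP, Finset.card_filter, Fintype.sum_prod_type]
        simp only [Finset.card_filter]
      rw [e]; push_cast
      rw [← nsmul_eq_mul]
      refine (Finset.card_nsmul_le_sum R0 (fun r => ((Finset.univ.filter (fun b => S r b ≠ 0)).card : ℝ)) (α * n) ?_).trans ?_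
      · intro r hr
        simp only [hR0, Finset.mem_filter, Finset.mem_univ, true_and] at hr
        exact (code_dist hX (S r) (hSC r) hr).le
      · exact Finset.sum_le_sum_of_subset_of_nonneg (Finset.subset_univ _) (fun _ _ _ => Nat.cast_nonneg _)
    have h2 : P.card ≤ (E ×ˢ (Finset.univ : Finset (Fin 6))).card := by
      apply Finset.card_le_card_of_surjOn (fun q => (f q.1.1 q.2, q.1.2))
      rintro ⟨r, b⟩ hrb
      simp only [hP, Finset.coe_filter, Set.mem_ofPred_eq, Finset.mem_univ, true_and] at hrb
      rw [← hSd, chk_apply] at hrb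
      obtain ⟨i, _, hi⟩ := Finset.exists_ne_zero_of_sum_ne_zero hrb
      obtain ⟨j, _, hj⟩ := Finset.exists_ne_zero_of_sum_ne_zero hi
      refine ⟨((i, b), j), ?_, ?_⟩
      · simp only [Finset.coe_product, Set.mem_prod, Finset.mem_coe, hE, Finset.mem_filter, Finset.mem_univ, true_and, and_true]
        intro h; apply hj; simp [h]
      · have : f i j = r := by by_contra h; apply hj; rw [if_neg h]
        simp [this]
    rw [Finset.card_product] at h2
    simp at h2
    have : (P.card : ℝ) ≤ E.card * 6 := by exact_mod_cast h2
    linarith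
  by_cases hRs : (R0.card : ℝ) ≤ α * n
  swap
  · push Not at hRs
    apply zerocase
    have : 0 < α * n := by positivity
    nlinarith
  obtain ⟨L, T, hLc, hTT, hLT, hLv⟩ := closure_L hX R0 hRs
  set B := Finset.univ.filter (fun b => ∃ a, a ∉ L ∧ w1 a b - w2 a b ≠ 0) with hB
  have hBc : B.card * (α * n) ≤ E.card := by
    have h1 : ∀ b ∈ B, α * n ≤ ((Finset.univ.filter (fun a => w1 a b ≠ w2 a b)).card : ℝ) := by
      intro b hb
      simp only [hB, Finset.mem_filter, Finset.mem_univ, true_and] at hb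
      have := key_uniq hX (fun a => w1 a b - w2 a b) L T (by
        intro r hr
        rw [hSd]
        have : r ∉ R0 := fun h => hr (hTT h)
        simp only [hR0, Finset.mem_filter, Finset.mem_univ, true_and, not_not] at this
        rw [this]; rfl) hLT hLv hb
      refine this.le.trans ?_
      apply Nat.cast_le.2
      apply Finset.card_le_card
      intro a ha
      simp only [Finset.mem_filter, Finset.mem_univ, true_and] at ha ⊢
      exact fun h => ha.2 (by rw [h, sub_self])
    have e : E.card = ∑ b, (Finset.univ.filter (fun a => w1 a b ≠ w2 a b)).card := by
      rw [hE, Finset.card_filter, Fintype.sum_prod_type_right]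
      simp only [Finset.card_filter]
    rw [e]; push_cast
    rw [← nsmul_eq_mul]
    refine (Finset.card_nsmul_le_sum B (fun b => ((Finset.univ.filter (fun a => w1 a b ≠ w2 a b)).card : ℝ)) (α * n) h1).trans ?_
    exact Finset.sum_le_sum_of_subset_of_nonneg (Finset.subset_univ _) (fun _ _ _ => Nat.cast_nonneg _)
  by_cases hBs : (B.card : ℝ) ≤ α * n
  swap
  · push Not at hBs
    apply zerocase
    have : 0 < α * n := by positivity
    nlinarith
  -- vanishing principle
  have small0 : ∀ x ∈ code f, ∀ Y : Finset (Fin n), (Y.card : ℝ) ≤ α * n → (∀ v, v ∉ Y → x v = 0) → x = 0 := by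
    intro x hx Y hY hv
    by_contra h0
    have h1 := code_dist hX x hx h0
    have h2 : (Finset.univ.filter (fun v => x v ≠ 0)).card ≤ Y.card := by
      apply Finset.card_le_card
      intro v hv'
      simp only [Finset.mem_filter, Finset.mem_univ, true_and] at hv'
      by_contra h; exact hv' (hv v h)
    have : ((Finset.univ.filter (fun v => x v ≠ 0)).card : ℝ) ≤ Y.card := by exact_mod_cast h2
    linarith
  set mask : (Fin n → ZMod 2) →ₗ[ZMod 2] (Fin n → ZMod 2) := LinearMap.pi (fun b => if b ∈ B then 0 else LinearMap.proj b) with hmask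
  have mask_apply : ∀ x b, mask x b = if b ∈ B then 0 else x b := by
    intro x b; simp only [hmask, LinearMap.pi_apply]; split_ifs <;> simp
  have hinj : LinearMap.ker (mask.comp (code f).subtype) = ⊥ := by
    rw [LinearMap.ker_eq_bot']
    intro x hx
    apply Subtype.ext
    apply small0 x.1 x.2 B hBs
    intro v hv
    have := congrFun hx v
    simp only [LinearMap.comp_apply, Submodule.subtype_apply, mask_apply, if_neg hv] at this
    simpa using this
  obtain ⟨g, hg⟩ := LinearMap.exists_leftInverse_of_injective _ hinj
  have hg' : ∀ x ∈ code f, (g (mask x) : Fin n → ZMod 2) = x := by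
    intro x hx
    have := LinearMap.congr_fun hg ⟨x, hx⟩
    exact congrArg Subtype.val this
  set w : Fin n → Fin n → ZMod 2 := fun a => (g (mask (w2 a)) : Fin n → ZMod 2) with hw
  have hwr : ∀ a, w a ∈ code f := fun a => (g (mask (w2 a))).2
  have hwc : ∀ b, (fun a => w a b) ∈ code f := by
    intro b
    set φ : (Fin n → ZMod 2) →ₗ[ZMod 2] ZMod 2 := (LinearMap.proj b).comp ((code f).subtype.comp (g.comp mask)) with hφ
    have : (fun a => w a b) = ∑ b', (φ (fun j => if b' = j then 1 else 0)) • (fun a => w2 a b') := by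
      ext a
      have := LinearMap.pi_apply_eq_sum_univ φ (w2 a)
      have e : w a b = φ (w2 a) := rfl
      rw [e, this]
      simp only [Finset.sum_apply, Pi.smul_apply, smul_eq_mul]
      apply Finset.sum_congr rfl; intro b' _; ring
    rw [this]
    apply Submodule.sum_mem; intro b' _
    exact Submodule.smul_mem _ _ (hw2 b')
  have hrow : ∀ a, a ∉ L → w a = w1 a := by
    intro a ha
    have : mask (w2 a) = mask (w1 a) := by
      ext b
      rw [mask_apply, mask_apply]
      split_ifs with hb
      · rfl
      · simp only [hB, Finset.mem_filter, Finset.mem_univ, true_and] at hb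
        push Not at hb
        exact (sub_eq_zero.1 (hb a ha)).symm
    simp only [hw, this]
    exact hg' _ (hw1 a)
  have hcol : ∀ b, b ∉ B → (fun a => w a b) = (fun a => w2 a b) := by
    intro b hb
    have := small0 ((fun a => w a b) - (fun a => w2 a b)) (Submodule.sub_mem _ (hwc b) (hw2 b)) L 
      (le_trans (by exact_mod_cast hLc) hRs) (by
        intro v hv
        simp only [Pi.sub_apply]
        simp only [hB, Finset.mem_filter, Finset.mem_univ, true_and] at hb
        push Not at hb
        rw [hrow v hv]; exact hb v hv)
    exact sub_eq_zero.1 this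
  refine ⟨w, ⟨hwr, hwc⟩, ?_⟩
  have c1 : (Finset.univ.filter (fun a => w a ≠ w1 a)).card ≤ R0.card := by
    refine le_trans (Finset.card_le_card ?_) hLc
    intro a ha
    simp only [Finset.mem_filter, Finset.mem_univ, true_and] at ha
    by_contra h; exact ha (hrow a h)
  have c2 : (Finset.univ.filter (fun b => (fun a => w a b) ≠ (fun a => w2 a b))).card ≤ B.card := by
    apply Finset.card_le_card
    intro b hb
    simp only [Finset.mem_filter, Finset.mem_univ, true_and] at hb
    by_contra h; exact hb (hcol b h)
  have c3 : (((Finset.univ.filter (fun a => w a ≠ w1 a)).card + (Finset.univ.filter (fun b => (fun a => w a b) ≠ (fun a => w2 a b))).card : ℕ) : ℝ) ≤ R0.card + B.card := by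
    exact_mod_cast add_le_add c1 c2
  refine (mul_le_mul_of_nonneg_left c3 (by positivity)).trans ?_
  have h7 : (R0.card + B.card : ℝ) * (α * n) ≤ 7 * E.card := by linarith
  have hR : (0:ℝ) ≤ (R0.card + B.card : ℝ) * (α * n) := by positivity
  have : α ^ 2 / 24 * n * (R0.card + B.card : ℝ) = (α / 24) * ((R0.card + B.card : ℝ) * (α * n)) := by ring
  rw [this]
  have hEn : (0:ℝ) ≤ E.card := Nat.cast_nonneg _
  nlinarith
end


lemma choose_bd (n k : ℕ) : n.choose k * k ^ k ≤ (3 * n) ^ k := by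
  have h1 : (n.choose k : ℝ) ≤ (n:ℝ) ^ k / k.factorial := Nat.choose_le_pow_div k n
  have h2 := Real.pow_div_factorial_le_exp (k:ℝ) (Nat.cast_nonneg _) k
  have h3 : Real.exp k ≤ 3 ^ k := by
    have : Real.exp k = Real.exp 1 ^ k := by rw [← Real.exp_nat_mul]; simp
    rw [this]
    exact pow_le_pow_left₀ (Real.exp_pos _).le (by have := Real.exp_one_lt_d9; linarith) k
  have : ((n.choose k * k ^ k : ℕ) : ℝ) ≤ ((3 * n) ^ k : ℕ) := by
    push_cast
    calc (n.choose k : ℝ) * (k:ℝ) ^ k ≤ ((n:ℝ) ^ k / k.factorial) * (k:ℝ) ^ k := by gcongr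
      _ = (n:ℝ) ^ k * ((k:ℝ) ^ k / k.factorial) := by ring
      _ ≤ (n:ℝ) ^ k * 3 ^ k := by gcongr; exact h2.trans h3
      _ = _ := by rw [mul_pow]; ring
  exact_mod_cast this

lemma count_bd (n m k : ℕ) (h : 15552 * n * k ≤ m ^ 2) :
    n.choose k * m.choose (4 * k) * (4 * k) ^ (6 * k) * 4 ^ k ≤ m ^ (6 * k) := by
  have h1 := choose_bd n k
  have h2 := choose_bd m (4 * k)
  calc n.choose k * m.choose (4 * k) * (4 * k) ^ (6 * k) * 4 ^ k
      = (n.choose k * k ^ k) * (m.choose (4 * k) * (4 * k) ^ (4 * k)) * (64 * k) ^ k := by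
        have : (6 * k) = 4 * k + k + k := by ring
        rw [this, pow_add, pow_add, mul_pow 64, mul_pow 4 k k, show (64:ℕ) = 4 ^ 3 by norm_num, ← pow_mul]
        ring
    _ ≤ (3 * n) ^ k * (3 * m) ^ (4 * k) * (64 * k) ^ k := by gcongr
    _ = (15552 * n * k) ^ k * m ^ (4 * k) := by
        rw [mul_pow 3 m, pow_mul 3, mul_pow, mul_pow, mul_pow, mul_pow]
        rw [show (15552:ℕ) = 3 * 3 ^ 4 * 64 by norm_num, mul_pow, mul_pow]
        ring
    _ ≤ (m ^ 2) ^ k * m ^ (4 * k) := by gcongr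
    _ = m ^ (6 * k) := by rw [← pow_mul, ← pow_add]; ring_nf

lemma geo_lt (K : ℕ) : ∑ k ∈ Finset.Icc 1 K, (1/4 : ℝ) ^ k < 1 := by
  have : ∑ k ∈ Finset.Icc 1 K, (1/4 : ℝ) ^ k ≤ 1 - (1/2) ^ K := by
    induction K with
    | zero => simp
    | succ K ih =>
      rw [Finset.sum_Icc_succ_top (by omega)]
      have : (1/4 : ℝ) ^ (K+1) ≤ (1/2) ^ (K+1) := by gcongr; norm_num
      rw [pow_succ (1/2 : ℝ)] at this ⊢
      linarith
  have : (0:ℝ) < (1/2) ^ K := by positivity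
  linarith

open Classical in
lemma lossless_count (n m K : ℕ) (hm : 0 < m) (hK : K ≤ n) (hK4 : 4 * K ≤ m) (h : 15552 * n * K ≤ m ^ 2) :
    ∃ f : Fin n → Fin 6 → Fin m, ∀ X : Finset (Fin n), X.Nonempty → X.card ≤ K → 4 * X.card < (Nb f X).card := by
  set P : Finset (Fin n) → Finset (Fin m) → Finset (Fin n → Fin 6 → Fin m) := fun X Y =>
    Fintype.piFinset (fun i => Fintype.piFinset (fun _ => if i ∈ X then Y else Finset.univ)) with hP
  have hPc : ∀ k X Y, X.card = k → Y.card = 4 * k → (P X Y).card = (4 * k) ^ (6 * k) * m ^ (6 * (n - k)) := by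
    intro k X Y hX hY
    simp only [hP, Fintype.card_piFinset]
    have : ∀ i, ∏ _j : Fin 6, (if i ∈ X then Y else Finset.univ).card = if i ∈ X then (4 * k) ^ 6 else m ^ 6 := by
      intro i; split_ifs <;> simp [hY]
    simp only [this]
    rw [Finset.prod_ite, Finset.prod_const, Finset.prod_const]
    have e1 : (Finset.univ.filter (fun i => i ∈ X)).card = k := by simp [hX]
    have e2 : (Finset.univ.filter (fun i => i ∉ X)).card = n - k := by
      have := Finset.card_compl X
      rw [hX, Fintype.card_fin] at this
      rw [← this]; congr 1; ext i; simp
    rw [e1, e2, ← pow_mul, ← pow_mul]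
  set bad := (Finset.Icc 1 K).biUnion (fun k => (Finset.powersetCard k (Finset.univ : Finset (Fin n))).biUnion (fun X =>
    (Finset.powersetCard (4 * k) (Finset.univ : Finset (Fin m))).biUnion (fun Y => P X Y))) with hbad
  have hbc : bad.card ≤ ∑ k ∈ Finset.Icc 1 K, n.choose k * (m.choose (4 * k) * ((4 * k) ^ (6 * k) * m ^ (6 * (n - k)))) := by
    refine Finset.card_biUnion_le.trans ?_
    apply Finset.sum_le_sum; intro k _
    refine (Finset.card_biUnion_le_card_mul _ _ (m.choose (4 * k) * ((4 * k) ^ (6 * k) * m ^ (6 * (n - k)))) ?_).trans ?_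
    · intro X hX
      rw [Finset.mem_powersetCard] at hX
      refine (Finset.card_biUnion_le_card_mul _ _ ((4 * k) ^ (6 * k) * m ^ (6 * (n - k))) ?_).trans ?_
      · intro Y hY
        rw [Finset.mem_powersetCard] at hY
        exact (hPc k X Y hX.2 hY.2).le
      · simp
    · simp
  have hlt : bad.card < Fintype.card (Fin n → Fin 6 → Fin m) := by
    have hcard : Fintype.card (Fin n → Fin 6 → Fin m) = m ^ (6 * n) := by
      simp [pow_mul]
    rw [hcard]
    have h1 : ∀ k ∈ Finset.Icc 1 K, ((n.choose k * (m.choose (4 * k) * ((4 * k) ^ (6 * k) * m ^ (6 * (n - k)))) : ℕ) : ℝ) ≤ (1/4) ^ k * m ^ (6 * n) := by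
      intro k hk
      rw [Finset.mem_Icc] at hk
      have hc := count_bd n m k (le_trans (by gcongr; exact hk.2) h)
      have hc' : (n.choose k * (m.choose (4 * k) * ((4 * k) ^ (6 * k) * m ^ (6 * (n - k))))) * 4 ^ k ≤ m ^ (6 * n) := by
        calc _ = (n.choose k * m.choose (4 * k) * (4 * k) ^ (6 * k) * 4 ^ k) * m ^ (6 * (n - k)) := by ring
          _ ≤ m ^ (6 * k) * m ^ (6 * (n - k)) := by gcongr
          _ = m ^ (6 * n) := by rw [← pow_add]; congr 1; omega
      have hc'' : ((n.choose k * (m.choose (4 * k) * ((4 * k) ^ (6 * k) * m ^ (6 * (n - k)))) : ℕ) : ℝ) * 4 ^ k ≤ m ^ (6 * n) := by exact_mod_cast hc'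
      have h4 : (0:ℝ) < 4 ^ k := by positivity
      rw [one_div, inv_pow, inv_mul_eq_div, le_div_iff₀ h4]
      exact hc''
    have h2 : (bad.card : ℝ) ≤ ∑ k ∈ Finset.Icc 1 K, (1/4 : ℝ) ^ k * m ^ (6 * n) := by
      refine le_trans (Nat.cast_le.2 hbc) ?_
      rw [Nat.cast_sum]
      exact Finset.sum_le_sum h1
    rw [← Finset.sum_mul] at h2
    have h3 : (0:ℝ) < m ^ (6 * n) := by positivity
    have h4 := geo_lt K
    have : (bad.card : ℝ) < m ^ (6 * n) := by nlinarith
    exact_mod_cast this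
  obtain ⟨f, hf⟩ : ∃ f, f ∉ bad := by
    by_contra hc
    push Not at hc
    have : bad = Finset.univ := Finset.eq_univ_iff_forall.2 hc
    rw [this, Finset.card_univ] at hlt
    exact lt_irrefl _ hlt
  refine ⟨f, fun X hXn hXK => ?_⟩
  by_contra hcon
  push Not at hcon
  apply hf
  obtain ⟨Y, hY1, hY2⟩ := Finset.exists_superset_card_eq hcon (by simp; omega)
  simp only [hbad, Finset.mem_biUnion, Finset.mem_powersetCard]
  refine ⟨X.card, Finset.mem_Icc.2 ⟨Finset.card_pos.2 hXn, hXK⟩, X, ⟨Finset.subset_univ _, rfl⟩, Y, ⟨Finset.subset_univ _, hY2⟩, ?_⟩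
  simp only [hP, Fintype.mem_piFinset]
  intro i j
  split_ifs with hi
  · apply hY1
    simp only [Nb, Finset.mem_biUnion, Finset.mem_image, Finset.mem_univ, true_and]
    exact ⟨i, hi, j, rfl⟩
  · exact Finset.mem_univ _

lemma lossless_exists (ε : ℝ) (hε : 0 < ε) (hε1 : ε ≤ 1) : ∃ α : ℝ, 0 < α ∧ α ≤ 1 ∧ ∃ n0 : ℕ, ∀ n ≥ n0, ∃ m : ℕ, 0 < m ∧ (m : ℝ) ≤ ε * n ∧
    ∃ f : Fin n → Fin 6 → Fin m, Lossless f α := by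
  refine ⟨ε ^ 2 / 65536, by positivity, by nlinarith, ⌈1 / ε⌉₊, fun n hn => ?_⟩
  have hn1 : 1 ≤ ε * n := by
    have := (Nat.ceil_le.1 hn)
    rw [div_le_iff₀ hε] at this
    linarith
  have hn0 : (0:ℝ) < n := by
    by_contra h
    nlinarith
  have hfl : ⌊ε * n⌋₊ ≤ ε * n := Nat.floor_le (by positivity)
  have hfg : ε * n < ⌊ε * n⌋₊ + 1 := Nat.lt_floor_add_one _
  have hm1 : 1 ≤ ⌊ε * n⌋₊ := Nat.le_floor (by exact_mod_cast hn1)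
  set m := ⌊ε * n⌋₊ with hm
  have hm1' : (1:ℝ) ≤ m := by exact_mod_cast hm1
  have hm2 : ε * n / 2 ≤ m := by linarith
  set K := ⌊ε ^ 2 / 65536 * n⌋₊ with hKd
  have hKl : (K : ℝ) ≤ ε ^ 2 / 65536 * n := Nat.floor_le (by positivity)
  have hee : ε ^ 2 ≤ ε := by nlinarith
  have hen : ε ^ 2 * n ≤ ε * n := by gcongr
  have hen1 : ε * n ≤ n := by nlinarith
  obtain ⟨f, hf⟩ := lossless_count n m K hm1 (by
      have : (K:ℝ) ≤ n := by linarith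
      exact_mod_cast this) (by
      have : 4 * (K:ℝ) ≤ m := by linarith
      exact_mod_cast this) (by
      have : 15552 * (n:ℝ) * K ≤ (m:ℝ) ^ 2 := by
        have a1 : (ε * n / 2) ^ 2 ≤ (m:ℝ) ^ 2 := pow_le_pow_left₀ (by positivity) hm2 2
        have a2 : 15552 * (n:ℝ) * K ≤ 15552 * (n:ℝ) * (ε ^ 2 / 65536 * n) := by gcongr
        have a3 : 0 ≤ (ε * n) ^ 2 := by positivity
        nlinarith
      exact_mod_cast this)
  refine ⟨m, hm1, hfl, f, fun X hX hXc => hf X hX ?_⟩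
  exact Nat.le_floor hXc


lemma hn_comp {F F' : Type} [Fintype F] [Fintype F'] (e : F ≃ F') (x : F' → ZMod 2) :
    hammingNorm (fun i => x (e i)) = hammingNorm x := by
  unfold hammingNorm
  apply Finset.card_bij (fun i _ => e i)
  · intro i hi; simpa using hi
  · intro i _ j _ h; exact e.injective h
  · intro j hj; exact ⟨e.symm j, by simpa using hj, by simp⟩

open Classical in
theorem transfer {F R : Type} [Fintype F] [Fintype R] (Φ : (F → ZMod 2) →ₗ[ZMod 2] (R → ZMod 2))
    (w N : ℕ) (δ K r : ℝ) (hK : 0 < K) (hr0 : 0 < r) (hN : N ≤ Fintype.card F) (hR : 1 ≤ Fintype.card R)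
    (hw : ∀ i, (Finset.univ.filter (fun j => Φ (Pi.single j 1) i ≠ 0)).card ≤ w)
    (hrate : (Fintype.card R : ℝ) ≤ (1 - r) * Fintype.card F)
    (hd : ∀ x, Φ x = 0 → x ≠ 0 → δ * Fintype.card F ≤ hammingNorm x)
    (ht : ∀ x, ∃ c, Φ c = 0 ∧ (hammingDist x c : ℝ) ≤ K * hammingNorm (Φ x)) :
    ∃ (n m : ℕ) (H : Matrix (Fin m) (Fin n) (ZMod 2)),
        N ≤ n ∧ 1 ≤ m ∧
        (∀ i : Fin m, hammingNorm (H i) ≤ w) ∧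
        r * n ≤ (Module.finrank (ZMod 2) (LinearMap.ker H.mulVecLin) : ℝ) ∧
        (∀ x ∈ LinearMap.ker H.mulVecLin, x ≠ 0 → δ * n ≤ (hammingNorm x : ℝ)) ∧
        (∀ x : Fin n → ZMod 2, ∃ c ∈ LinearMap.ker H.mulVecLin,
          (1 / K / n) * (hammingDist x c : ℝ) ≤ (1 / m) * (hammingNorm (H.mulVec x) : ℝ)) := by
  obtain ⟨eF⟩ : Nonempty (F ≃ Fin (Fintype.card F)) := ⟨Fintype.equivFin F⟩
  obtain ⟨eR⟩ : Nonempty (Fin (Fintype.card R) ≃ R) := ⟨(Fintype.equivFin R).symm⟩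
  set n := Fintype.card F with hn
  set m := Fintype.card R with hm
  set Ψ : (Fin n → ZMod 2) →ₗ[ZMod 2] (Fin m → ZMod 2) :=
    (LinearMap.funLeft (ZMod 2) (ZMod 2) eR).comp (Φ.comp (LinearMap.funLeft (ZMod 2) (ZMod 2) eF)) with hΨ
  have Ψa : ∀ x i, Ψ x i = Φ (fun j => x (eF j)) (eR i) := fun x i => rfl
  have Ψ0 : ∀ x, Ψ x = 0 ↔ Φ (fun j => x (eF j)) = 0 := by
    intro x
    constructor
    · intro h; ext i
      have := congrFun h (eR.symm i)
      rw [Ψa] at this; simpa using this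
    · intro h; ext i; rw [Ψa, h]; rfl
  have hH : (LinearMap.toMatrix' Ψ).mulVecLin = Ψ := by
    rw [← Matrix.toLin'_apply', Matrix.toLin'_toMatrix']
  refine ⟨n, m, LinearMap.toMatrix' Ψ, hN, hR, ?_, ?_, ?_, ?_⟩
  · intro i
    refine le_trans ?_ (hw (eR i))
    unfold hammingNorm
    apply Finset.card_le_card_of_injOn eF.symm
    · intro j hj
      simp only [Finset.coe_filter, Finset.mem_univ, true_and, Set.mem_ofPred_eq] at hj ⊢
      rw [LinearMap.toMatrix'_apply, Ψa] at hj
      have hs : (fun k => (Pi.single j 1 : Fin n → ZMod 2) (eF k)) = Pi.single (eF.symm j) 1 := by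
        ext k
        by_cases h : k = eF.symm j
        · subst h; simp
        · have : eF k ≠ j := fun h' => h (by rw [← h']; simp)
          simp [Pi.single_apply, h, this]
      rw [hs] at hj
      convert hj
    · intro a _ b _ h; exact eF.symm.injective h
  · rw [hH]
    have h1 := LinearMap.finrank_range_add_finrank_ker Ψ
    have h2 := Submodule.finrank_le (LinearMap.range Ψ)
    simp only [Module.finrank_fin_fun] at h1 h2
    have h1' : (Module.finrank (ZMod 2) (LinearMap.range Ψ) : ℝ) + (Module.finrank (ZMod 2) (LinearMap.ker Ψ) : ℝ) = n := by exact_mod_cast h1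
    have h2' : (Module.finrank (ZMod 2) (LinearMap.range Ψ) : ℝ) ≤ m := by exact_mod_cast h2
    linarith
  · rw [hH]
    intro x hx hx0
    rw [LinearMap.mem_ker] at hx
    have := hd _ ((Ψ0 x).1 hx) (by
      intro h; apply hx0; ext j
      have := congrFun h (eF.symm j)
      simpa using this)
    rwa [hn_comp] at this
  · intro x
    rw [hH]
    obtain ⟨c, hc0, hc⟩ := ht (fun j => x (eF j))
    refine ⟨fun j => c (eF.symm j), ?_, ?_⟩
    · rw [LinearMap.mem_ker, Ψ0]; simpa using hc0
    · have e1 : (LinearMap.toMatrix' Ψ).mulVec x = Ψ x := by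
        conv_rhs => rw [← hH]
        rfl
      have e2 : hammingNorm (Ψ x) = hammingNorm (Φ (fun j => x (eF j))) := hn_comp eR _
      have e3 : hammingDist x (fun j => c (eF.symm j)) = hammingDist (fun j => x (eF j)) c := by
        rw [hammingDist_eq_hammingNorm, hammingDist_eq_hammingNorm, ← hn_comp eF]
        congr 1; ext j; simp
      rw [e1, e2, e3]
      have hm0 : (0:ℝ) < m := by exact_mod_cast hR
      have hmn : (m:ℝ) ≤ n := by
        have : (0:ℝ) ≤ n := Nat.cast_nonneg _
        nlinarith
      have hn0 : (0:ℝ) < n := by linarith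
      calc 1 / K / n * (hammingDist (fun j => x (eF j)) c : ℝ) ≤ 1 / K / n * (K * hammingNorm (Φ (fun j => x (eF j)))) := by gcongr
        _ = 1 / n * hammingNorm (Φ (fun j => x (eF j))) := by field_simp
        _ ≤ _ := by gcongr

section
open Classical
variable {G : Type} [Fintype G] [Group G] {Δ m : ℕ}

def fpi (A : Fin Δ → G) (v : Bool × Bool × G) (a b : Fin Δ) : G × Fin Δ × Fin Δ :=
  ((if v.1 then (A a)⁻¹ else 1) * v.2.2 * (if v.2.1 then (A b)⁻¹ else 1), a, b)

def lview (A : Fin Δ → G) (x : G × Fin Δ × Fin Δ → ZMod 2) (v : Bool × Bool × G) (a b : Fin Δ) : ZMod 2 := x (fpi A v a b)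

lemma lview_cons (A : Fin Δ → G) (x : G × Fin Δ × Fin Δ → ZMod 2) : Cons (nA A) (nB A) (lview A x) := by
  constructor
  · rintro ⟨s, t, h⟩ a b
    unfold lview; congr 1
    cases s <;> cases t <;> simp [fpi, nA, mul_assoc]
  · rintro ⟨s, t, h⟩ a b
    unfold lview; congr 1
    cases s <;> cases t <;> simp [fpi, nB, mul_assoc]

lemma lview_of_cons (A : Fin Δ → G) (T : Bool × Bool × G → Fin Δ → Fin Δ → ZMod 2) (hT : Cons (nA A) (nB A) T) :
    lview A (fun p => T (false, false, p.1) p.2.1 p.2.2) = T := by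
  ext ⟨s, t, h⟩ a b
  simp only [lview, fpi]
  cases s <;> cases t
  · simp
  · rw [← hT.2 (false, true, h) a b]; simp [nB]
  · rw [← hT.1 (true, false, h) a b]; simp [nA]
  · rw [← hT.1 (true, true, h) a b, ← hT.2 (nA A a (true, true, h)) a b]; simp [nA, nB]

noncomputable def bigΦ (A : Fin Δ → G) (f : Fin Δ → Fin 6 → Fin m) :
    (G × Fin Δ × Fin Δ → ZMod 2) →ₗ[ZMod 2] ((Bool × Bool × G) × Fin Δ × Fin m × Bool → ZMod 2) :=
  LinearMap.pi (fun i => if i.2.2.2 then 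
      (chk f i.2.2.1).comp (LinearMap.funLeft (ZMod 2) (ZMod 2) (fun b => fpi A i.1 i.2.1 b))
    else (chk f i.2.2.1).comp (LinearMap.funLeft (ZMod 2) (ZMod 2) (fun a => fpi A i.1 a i.2.1)))

lemma bigΦ_t (A : Fin Δ → G) (f : Fin Δ → Fin 6 → Fin m) (x v a r) :
    bigΦ A f x (v, a, r, true) = chk f r (lview A x v a) := rfl
lemma bigΦ_f (A : Fin Δ → G) (f : Fin Δ → Fin 6 → Fin m) (x v b r) :
    bigΦ A f x (v, b, r, false) = chk f r (fun a => lview A x v a b) := rfl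

lemma notCC_iff (A : Fin Δ → G) (f : Fin Δ → Fin 6 → Fin m) (x v) :
    ¬ CC (code f) (lview A x v) ↔ ∃ i, bigΦ A f x (v, i) ≠ 0 := by
  constructor
  · intro h
    by_contra hc
    push Not at hc
    apply h
    constructor
    · intro a; rw [mem_code]; intro r; rw [← bigΦ_t]; exact hc _
    · intro b; rw [mem_code]; intro r; rw [← bigΦ_f]; exact hc _
  · rintro ⟨⟨a, r, s⟩, hi⟩ h
    cases s
    · rw [bigΦ_f] at hi; exact hi ((mem_code f _).1 (h.2 a) r)
    · rw [bigΦ_t] at hi; exact hi ((mem_code f _).1 (h.1 a) r)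

lemma bigΦ_zero (A : Fin Δ → G) (f : Fin Δ → Fin 6 → Fin m) (x) :
    bigΦ A f x = 0 ↔ ∀ v, CC (code f) (lview A x v) := by
  constructor
  · intro h v
    by_contra hc
    obtain ⟨i, hi⟩ := (notCC_iff A f x v).1 hc
    rw [h] at hi; exact hi rfl
  · intro h; ext ⟨v, i⟩
    by_contra hc
    exact (notCC_iff A f x v).2 ⟨i, hc⟩ (h v)

lemma bad_le (A : Fin Δ → G) (f : Fin Δ → Fin 6 → Fin m) (x) :
    (Finset.univ.filter (fun v => ¬ CC (code f) (lview A x v))).card ≤ hammingNorm (bigΦ A f x) := by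
  unfold hammingNorm
  apply Finset.card_le_card_of_surjOn Prod.fst
  intro v hv
  simp only [Finset.coe_filter, Finset.mem_univ, true_and, Set.mem_ofPred_eq] at hv
  obtain ⟨i, hi⟩ := (notCC_iff A f x v).1 hv
  exact ⟨(v, i), by simpa using hi, rfl⟩

lemma chk_ne (f : Fin Δ → Fin 6 → Fin m) (r) (x : Fin Δ → ZMod 2) (h : chk f r x ≠ 0) : ∃ i, x i ≠ 0 := by
  by_contra hc
  push Not at hc
  apply h
  have : x = 0 := funext hc
  rw [this, map_zero]

lemma row_wt (A : Fin Δ → G) (f : Fin Δ → Fin 6 → Fin m) (i) :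
    (Finset.univ.filter (fun j => bigΦ A f (Pi.single j 1) i ≠ 0)).card ≤ Δ := by
  obtain ⟨v, a, r, s⟩ := i
  have key : ∀ g : Fin Δ → G × Fin Δ × Fin Δ, (∀ j, bigΦ A f (Pi.single j 1) (v, a, r, s) = chk f r (fun b => (Pi.single j 1 : G × Fin Δ × Fin Δ → ZMod 2) (g b))) →
      (Finset.univ.filter (fun j => bigΦ A f (Pi.single j 1) (v, a, r, s) ≠ 0)).card ≤ Δ := by
    intro g hg
    have : Finset.univ.filter (fun j => bigΦ A f (Pi.single j 1) (v, a, r, s) ≠ 0) ⊆ Finset.univ.image g := by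
      intro j hj
      simp only [Finset.mem_filter, Finset.mem_univ, true_and, hg] at hj
      obtain ⟨b, hb⟩ := chk_ne f r _ hj
      simp only [Finset.mem_image, Finset.mem_univ, true_and]
      refine ⟨b, ?_⟩
      by_contra h
      apply hb; simp [Pi.single_apply, h]
    refine (Finset.card_le_card this).trans (Finset.card_image_le.trans ?_)
    simp
  cases s
  · exact key (fun b => fpi A v b a) (fun j => rfl)
  · exact key (fun b => fpi A v a b) (fun j => rfl)

lemma supp_le (A : Fin Δ → G) (x : G × Fin Δ × Fin Δ → ZMod 2) :
    (Finset.univ.filter (fun v => lview A x v ≠ 0)).card ≤ hammingNorm x * 4 := by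
  have : hammingNorm x * 4 = ((Finset.univ.filter (fun p => x p ≠ 0)) ×ˢ (Finset.univ : Finset (Bool × Bool))).card := by
    rw [Finset.card_product]; simp [hammingNorm]
  rw [this]
  apply Finset.card_le_card_of_surjOn (fun q => (q.2.1, q.2.2, (if q.2.1 then A q.1.2.1 else 1) * q.1.1 * (if q.2.2 then A q.1.2.2 else 1)))
  rintro ⟨s, t, h⟩ hv
  simp only [Finset.coe_filter, Finset.mem_univ, true_and, Set.mem_ofPred_eq] at hv
  obtain ⟨a, ha⟩ := Function.ne_iff.1 hv
  obtain ⟨b, hb⟩ := Function.ne_iff.1 ha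
  refine ⟨(fpi A (s, t, h) a b, s, t), ?_, ?_⟩
  · simp only [Finset.coe_product, Set.mem_prod, Finset.mem_coe, Finset.mem_filter, Finset.mem_univ, true_and, and_true]
    exact hb
  · cases s <;> cases t <;> simp [fpi, mul_assoc]

lemma dist_le (A : Fin Δ → G) (x : G × Fin Δ × Fin Δ → ZMod 2) (T : Bool × Bool × G → Fin Δ → Fin Δ → ZMod 2) :
    hammingDist x (fun p => T (false, false, p.1) p.2.1 p.2.2) ≤ (Finset.univ.filter (fun v => lview A x v ≠ T v)).card * (Δ * Δ) := by
  have : (Finset.univ.filter (fun v => lview A x v ≠ T v)).card * (Δ * Δ) = 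
     ((Finset.univ.filter (fun v => lview A x v ≠ T v)) ×ˢ (Finset.univ : Finset (Fin Δ × Fin Δ))).card := by
    rw [Finset.card_product]; simp
  rw [this]
  unfold hammingDist
  apply Finset.card_le_card_of_surjOn (fun q => (q.1.2.2, q.2.1, q.2.2))
  rintro ⟨g, a, b⟩ hp
  simp only [Finset.coe_filter, Finset.mem_univ, true_and, Set.mem_ofPred_eq] at hp
  refine ⟨((false, false, g), a, b), ?_, rfl⟩
  simp only [Finset.coe_product, Set.mem_prod, Finset.mem_coe, Finset.mem_filter, Finset.mem_univ, true_and, and_true]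
  intro h
  apply hp
  have := congrFun (congrFun h a) b
  simpa [lview, fpi] using this
end

/-- existence of c³-locally testable codes of every rate `r < 1`.
The code is `C(H) = ker (H.mulVecLin)`; `hammingNorm` is the Hamming weight;
the distance-to-code bound `(1/m)·|Hx| ≥ (s/n)·d(x,C)` is expressed by exhibiting
a codeword `c` realizing `(1/m)·|Hx| ≥ (s/n)·|x − c|` (the minimum is attained,
so this is equivalent). -/
theorem c3_locally_testable_codes_exist :
    ∀ r : ℝ, 0 < r → r < 1 →
    ∃ (δ s : ℝ) (w : ℕ), 0 < δ ∧ 0 < s ∧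
      ∀ N : ℕ, ∃ (n m : ℕ) (H : Matrix (Fin m) (Fin n) (ZMod 2)),
        N ≤ n ∧ 1 ≤ m ∧
        -- (i) every row of H has at most w nonzero entries
        (∀ i : Fin m, hammingNorm (H i) ≤ w) ∧
        -- (ii) the code has dimension at least r·n
        r * n ≤ (Module.finrank (ZMod 2) (LinearMap.ker H.mulVecLin) : ℝ) ∧
        -- (iii) every nonzero codeword has weight at least δ·n
        (∀ x ∈ LinearMap.ker H.mulVecLin, x ≠ 0 → δ * n ≤ (hammingNorm x : ℝ)) ∧
        -- (iv) local testability: (1/m)·|Hx| ≥ (s/n)·d(x, C)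
        (∀ x : Fin n → ZMod 2, ∃ c ∈ LinearMap.ker H.mulVecLin,
          (s / n) * (hammingDist x c : ℝ) ≤ (1 / m) * (hammingNorm (H.mulVec x) : ℝ)) := by
  classical
  intro r hr0 hr1
  obtain ⟨α, hα, hα1, n0, hex⟩ := lossless_exists ((1 - r) / 8) (by linarith) (by linarith)
  set κ : ℝ := α ^ 2 / 24 with hκ
  have hκ0 : 0 < κ := by positivity
  have hκα : κ < α := by rw [hκ]; nlinarith
  obtain ⟨D, hD, hexp⟩ := expanders (κ / 4) (by positivity)
  set θ : ℝ := κ ^ 2 / 16 with hθ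
  have hθ0 : 0 < θ := by positivity
  set μ : ℝ := Real.sqrt (θ + (κ / 4) ^ 2) with hμ
  have hμ0 : 0 ≤ μ := Real.sqrt_nonneg _
  have hμκ : 2 * μ < κ := by
    have : μ < κ / 2 := by
      rw [hμ, Real.sqrt_lt' (by positivity)]
      rw [hθ]; nlinarith [sq_nonneg κ, pow_pos hκ0 2]
    linarith
  obtain ⟨Δ, hΔd⟩ : ∃ Δ, Δ = D * (n0 + 1) := ⟨_, rfl⟩
  have hΔ : 0 < Δ := by rw [hΔd]; positivity
  have hΔn : n0 ≤ Δ := by rw [hΔd]; nlinarith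
  obtain ⟨m, hm, hmε, f, hf⟩ := hex Δ hΔn
  have hΔR : (0:ℝ) < Δ := by exact_mod_cast hΔ
  set K : ℝ := (4 * Δ + 1) * (Δ * Δ) + 4 * Δ ^ 3 / θ with hK
  have hK0 : 0 < K := by positivity
  refine ⟨θ / (8 * Δ ^ 2), 1 / K, Δ, by positivity, by positivity, fun N => ?_⟩
  obtain ⟨G, _, _, hN, hE⟩ := hexp (n0 + 1) N
  rw [← hΔd] at hE
  obtain ⟨A, hA⟩ := hE
  have hEx : Ex (fun i => Equiv.mulLeft (A i)) (κ / 4) := hA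
  have hSA := small_nA A (κ / 4) θ (by positivity) hθ0.le hEx
  have hSB := small_nB A (κ / 4) θ (by positivity) hθ0.le hEx
  rw [← hμ] at hSA hSB
  have hG0 : 0 < Fintype.card G := Fintype.card_pos
  have hGR : (0:ℝ) < Fintype.card G := by exact_mod_cast hG0
  have cF : Fintype.card (G × Fin Δ × Fin Δ) = Fintype.card G * (Δ * Δ) := by simp
  have cR : Fintype.card ((Bool × Bool × G) × Fin Δ × Fin m × Bool) = 8 * (Fintype.card G * Δ * m) := by
    simp; ring
  apply transfer (bigΦ A f) Δ N (θ / (8 * Δ ^ 2)) K r hK0 hr0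
  · rw [cF]; nlinarith [Nat.mul_pos hΔ hΔ]
  · rw [cR]
    have : 0 < Fintype.card G * Δ * m := by positivity
    omega
  · intro i; convert row_wt A f i
  · rw [cF, cR]; push_cast
    have : (Fintype.card G * Δ : ℝ) * m ≤ (Fintype.card G * Δ : ℝ) * ((1 - r) / 8 * Δ) := by gcongr
    nlinarith
  · intro x hx hx0
    by_contra hcon
    push Not at hcon
    rw [cF] at hcon; push_cast at hcon
    have e : θ / (8 * Δ ^ 2) * (Fintype.card G * (Δ * Δ)) = θ * Fintype.card G / 8 := by field_simp
    rw [e] at hcon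
    have h4 := supp_le A x
    have h4' : ((Finset.univ.filter (fun v => lview A x v ≠ 0)).card : ℝ) ≤ hammingNorm x * 4 := by exact_mod_cast h4
    have h0 := core_dist (nA A) (nB A) hΔ (code f) α μ (θ * Fintype.card G) hμ0 (by linarith)
      (fun y hy hy0 => by convert (code_dist hf y hy hy0).le) hSA (lview A x) (lview_cons A x) ((bigΦ_zero A f x).1 hx) (by
        have : 0 < θ * Fintype.card G := by positivity
        refine le_trans (le_of_eq ?_) (h4'.trans (by linarith))
        congr!)
    apply hx0
    ext ⟨g, a, b⟩
    have := congrFun (congrFun (h0 (false, false, g)) a) b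
    simpa [lview, fpi] using this
  · intro x
    have hb := bad_le A f x
    have hb' : ((Finset.univ.filter (fun v => ¬ CC (code f) (lview A x v))).card : ℝ) ≤ hammingNorm (bigΦ A f x) := by exact_mod_cast hb
    rcases core_test (nA A) (nB A) hΔ (code f) κ μ (θ * Fintype.card G) hμ0 hμκ (code_agr hf hα hα1) hSA hSB
      (nA2 A) (nB2 A) (nAne A) (nBne A) (nAB A) (lview A x) (lview_cons A x) with ⟨T, hT, hTC, hle⟩ | hle
    · refine ⟨fun p => T (false, false, p.1) p.2.1 p.2.2, ?_, ?_⟩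
      · rw [bigΦ_zero, lview_of_cons A T hT]; exact hTC
      · have h1 := dist_le A x T
        have h2 : hammingDist x (fun p => T (false, false, p.1) p.2.1 p.2.2) ≤ ((4 * Δ + 1) * hammingNorm (bigΦ A f x)) * (Δ * Δ) := by
          refine h1.trans ?_
          apply Nat.mul_le_mul_right
          refine le_trans (le_of_eq ?_) (hle.trans (Nat.mul_le_mul_left _ ?_))
          · congr!
          · refine le_trans (le_of_eq ?_) hb
            congr!
        have h2' : (hammingDist x (fun p => T (false, false, p.1) p.2.1 p.2.2) : ℝ) ≤ ((4 * Δ + 1) * hammingNorm (bigΦ A f x)) * (Δ * Δ) := by exact_mod_cast h2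
        refine h2'.trans ?_
        have : 0 ≤ 4 * (Δ:ℝ) ^ 3 / θ * hammingNorm (bigΦ A f x) := by positivity
        rw [hK]; nlinarith
    · refine ⟨0, map_zero _, ?_⟩
      have h1 : hammingDist x 0 ≤ Fintype.card (G × Fin Δ × Fin Δ) := hammingDist_le_card_fintype
      rw [cF] at h1
      have h1' : (hammingDist x 0 : ℝ) ≤ Fintype.card G * (Δ * Δ) := by exact_mod_cast h1
      have h3 : θ * Fintype.card G ≤ 4 * Δ * hammingNorm (bigΦ A f x) := by
        refine hle.trans ?_
        apply mul_le_mul_of_nonneg_left _ (by positivity)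
        refine le_trans (le_of_eq ?_) hb'
        congr!
      have h4 : (Fintype.card G : ℝ) ≤ 4 * Δ * hammingNorm (bigΦ A f x) / θ := by
        rw [le_div_iff₀ hθ0]; linarith
      refine h1'.trans ?_
      have h5 : (Fintype.card G : ℝ) * (Δ * Δ) ≤ 4 * Δ * hammingNorm (bigΦ A f x) / θ * (Δ * Δ) := by gcongr
      refine h5.trans ?_
      have h6 : 4 * Δ * hammingNorm (bigΦ A f x) / θ * (Δ * Δ) = 4 * (Δ:ℝ) ^ 3 / θ * hammingNorm (bigΦ A f x) := by ring
      rw [h6, hK]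
      have : 0 ≤ ((4 * Δ + 1) * (Δ * Δ) : ℝ) * hammingNorm (bigΦ A f x) := by positivity
      nlinarith
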